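/- Let H be a positive self-adjoint operator on a Hilbert space ℋ and let ℋ₊₁ ⊂ ℋ ⊂ ℋ₋₁ be the scale of spaces with respect to H, where ℋ₊₁ = D(H^{1/2}) with scalar product (x,y)₊₁ = (x,(H+1)y) and ℋ₋₁ is the space of continuous conjugate-linear forms on ℋ₊₁. For t ∈ [0,T], T > 0, let H(t) be a symmetric bilinear form on ℋ₊₁ × ℋ₊₁ such that c^{-1}(H+1) ≤ H(t)+1 ≤ c(H+1) for a constant c > 0, suppose t ↦ H(t) ∈ B(ℋ₊₁, ℋ₋₁) is continuously differentiable in the operator norm, and ±Ḣ(t) ≤ c(H+1) as forms. Then there exists a unitary propagator U(t,s) on ℋ such that for every x ∈ ℋ₊₁, t ↦ U(t,s)x ∈ ℋ₊₁ is continuous in t, and (d/dt)U(t,s)x = −iH(t)U(t,s)x (as an identity in ℋ₋₁) for all x ∈ ℋ₊₁. -/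

import Mathlib

open MeasureTheory Set Real Filter
open scoped Topology ComplexConjugate

section LinearODE

variable {E : Type*} [NormedAddCommGroup E] [NormedSpace ℝ E]

/-- Integral of a function with exponential growth. -/
theorem norm_integral_le_of_norm_le_exp_abs {h : ℝ → E} (hh : Continuous h) {C l : ℝ}
    (hl : 0 < l) (hb : ∀ r, ‖h r‖ ≤ C * exp (l * |r|)) (t : ℝ) :
    ‖∫ r in (0:ℝ)..t, h r‖ ≤ C / l * exp (l * |t|) := by
  have hC : 0 ≤ C := by simpa using (norm_nonneg _).trans (hb 0)
  have key : ∀ {h : ℝ → E}, Continuous h → (∀ r, ‖h r‖ ≤ C * exp (l * |r|)) →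
      ∀ t, 0 ≤ t → ‖∫ r in (0:ℝ)..t, h r‖ ≤ C / l * exp (l * |t|) := by
    intro h hh hb t ht
    have hcont : Continuous fun r : ℝ => C * exp (l * r) := by fun_prop
    calc ‖∫ r in (0:ℝ)..t, h r‖ ≤ ∫ r in (0:ℝ)..t, C * exp (l * r) := by
          refine intervalIntegral.norm_integral_le_of_norm_le ht ?_
            (hcont.intervalIntegrable _ _)
          refine Eventually.of_forall fun r hr => ?_
          simpa [abs_of_pos hr.1] using hb r
      _ = C / l * exp (l * t) - C / l * exp (l * 0) := by
          refine intervalIntegral.integral_eq_sub_of_hasDerivAt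
            (f := fun r => C / l * exp (l * r)) (fun r _ => ?_)
            (hcont.intervalIntegrable _ _)
          have := (((hasDerivAt_id r).const_mul l).exp).const_mul (C / l)
          refine this.congr_deriv ?_
          rw [mul_one]
          field_simp
          rfl
      _ ≤ C / l * exp (l * |t|) := by
          rw [abs_of_nonneg ht]
          have : 0 ≤ C / l * exp (l * 0) := by positivity
          linarith
  rcases le_total 0 t with ht | ht
  · exact key hh hb t ht
  · have h1 := key (h := fun r => h (-r)) (by fun_prop) (fun r => by simpa using hb (-r)) (-t)
      (by linarith)
    rw [intervalIntegral.integral_comp_neg, neg_zero, neg_neg,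
      intervalIntegral.integral_symm, norm_neg, abs_neg] at h1
    exact h1

/-- Global solvability of linear differential equations with bounded continuous coefficients. -/
theorem exists_hasDerivAt_linear_ode [CompleteSpace E] {M : ℝ → E →L[ℝ] E} (hM : Continuous M) {L : ℝ}
    (hL : ∀ t, ‖M t‖ ≤ L) (s : ℝ) (x : E) :
    ∃ v : ℝ → E, v s = x ∧ ∀ t, HasDerivAt v (M t (v t)) t := by
  suffices H : ∀ M : ℝ → E →L[ℝ] E, Continuous M → (∀ t, ‖M t‖ ≤ L) →
      ∃ v : ℝ → E, v 0 = x ∧ ∀ t, HasDerivAt v (M t (v t)) t by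
    obtain ⟨v, hv0, hv⟩ := H (fun t => M (t + s)) (by fun_prop) (fun t => hL _)
    refine ⟨fun t => v (t - s), by simpa using hv0, fun t => ?_⟩
    have := (hv (t - s)).comp_sub_const t s
    simpa using this
  intro M hM hL
  have hL0 : 0 ≤ L := (norm_nonneg _).trans (hL 0)
  set l : ℝ := 2 * (L + 1) with hl
  have hlpos : 0 < l := by positivity
  have hcont : ∀ g : BoundedContinuousFunction ℝ E,
      Continuous fun r => exp (l * |r|) • M r (g r) := fun g => by fun_prop
  have hbound : ∀ (g : BoundedContinuousFunction ℝ E) r,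
      ‖exp (l * |r|) • M r (g r)‖ ≤ (L * ‖g‖) * exp (l * |r|) := by
    intro g r
    rw [norm_smul, norm_of_nonneg (exp_pos _).le, mul_comm]
    gcongr
    exact (M r).le_of_opNorm_le_of_le (hL r) (g.norm_coe_le_norm r)
  have hIntegral : ∀ (g : BoundedContinuousFunction ℝ E) t,
      ‖exp (-(l * |t|)) • ∫ r in (0:ℝ)..t, exp (l * |r|) • M r (g r)‖ ≤ 1 / 2 * ‖g‖ := by
    intro g t
    rw [norm_smul, norm_of_nonneg (exp_pos _).le]
    calc exp (-(l * |t|)) * ‖∫ r in (0:ℝ)..t, exp (l * |r|) • M r (g r)‖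
        ≤ exp (-(l * |t|)) * (L * ‖g‖ / l * exp (l * |t|)) := by
          gcongr
          exact norm_integral_le_of_norm_le_exp_abs (hcont g) hlpos (hbound g) t
      _ = L / l * ‖g‖ := by
          rw [exp_neg]; field_simp
      _ ≤ 1 / 2 * ‖g‖ := by
          refine mul_le_mul_of_nonneg_right ?_ (norm_nonneg _)
          rw [div_le_div_iff₀ hlpos (by norm_num), hl]
          linarith
  have hprim : ∀ (g : BoundedContinuousFunction ℝ E) t,
      HasDerivAt (fun t => ∫ r in (0:ℝ)..t, exp (l * |r|) • M r (g r))
        (exp (l * |t|) • M t (g t)) t := fun g t =>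
    intervalIntegral.integral_hasDerivAt_right ((hcont g).intervalIntegrable _ _)
      ((hcont g).stronglyMeasurableAtFilter _ _) (hcont g).continuousAt
  let Φ : BoundedContinuousFunction ℝ E → BoundedContinuousFunction ℝ E := fun g =>
    BoundedContinuousFunction.ofNormedAddCommGroup
      (fun t => exp (-(l * |t|)) • (x + ∫ r in (0:ℝ)..t, exp (l * |r|) • M r (g r)))
      (by
        have : Continuous fun t => ∫ r in (0:ℝ)..t, exp (l * |r|) • M r (g r) :=
          continuous_iff_continuousAt.2 fun t => (hprim g t).continuousAt
        fun_prop)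
      (‖x‖ + 1 / 2 * ‖g‖)
      (fun t => by
        rw [smul_add]
        refine (norm_add_le _ _).trans (add_le_add ?_ (hIntegral g t))
        rw [norm_smul, norm_of_nonneg (exp_pos _).le]
        refine mul_le_of_le_one_left (norm_nonneg _) ?_
        rw [exp_le_one_iff]
        have := abs_nonneg t
        have : 0 ≤ l * |t| := by positivity
        linarith)
  have hΦ : ∀ g t, Φ g t =
      exp (-(l * |t|)) • (x + ∫ r in (0:ℝ)..t, exp (l * |r|) • M r (g r)) := fun _ _ => rfl
  have hcontr : ContractingWith (1 / 2) Φ := by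
    refine ⟨by norm_num, LipschitzWith.of_dist_le_mul fun g₁ g₂ => ?_⟩
    rw [BoundedContinuousFunction.dist_le (by positivity)]
    intro t
    rw [dist_eq_norm, dist_eq_norm, hΦ, hΦ, ← smul_sub, add_sub_add_left_eq_sub,
      ← intervalIntegral.integral_sub ((hcont g₁).intervalIntegrable _ _)
        ((hcont g₂).intervalIntegrable _ _)]
    have := hIntegral (g₁ - g₂) t
    simp only [BoundedContinuousFunction.coe_sub, Pi.sub_apply, map_sub, smul_sub] at this
    simpa using this
  obtain ⟨g, hg⟩ : ∃ g, Φ g = g := ⟨_, hcontr.fixedPoint_isFixedPt⟩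
  have hgt : ∀ t, exp (l * |t|) • g t = x + ∫ r in (0:ℝ)..t, exp (l * |r|) • M r (g r) := by
    intro t
    conv_lhs => rw [← hg, hΦ, smul_smul, ← exp_add]
    simp
  refine ⟨fun t => exp (l * |t|) • g t, by simpa using hgt 0, fun t => ?_⟩
  have h1 := (hprim g t).const_add x
  rw [map_smul]
  exact h1.congr_of_eventuallyEq (Eventually.of_forall hgt)

end LinearODE

/-- A two-sided differential inequality implies exponential growth bounds. -/
theorem le_exp_mul_of_eventually_slope_lt {f : ℝ → ℝ} (hf : Continuous f) {k : ℝ}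
    (h : ∀ t r, k * f t < r → ∀ᶠ z in 𝓝[≠] t, |z - t|⁻¹ * (f z - f t) < r) (t s : ℝ) :
    f t ≤ exp (k * |t - s|) * f s := by
  have key : ∀ f : ℝ → ℝ, Continuous f →
      (∀ t r, k * f t < r → ∀ᶠ z in 𝓝[≠] t, |z - t|⁻¹ * (f z - f t) < r) →
      ∀ t s, s ≤ t → f t ≤ exp (k * |t - s|) * f s := by
    intro f hf h t s hst
    have := le_gronwallBound_of_liminf_deriv_right_le (f := f) (f' := fun t => k * f t)
      (δ := f s) (K := k) (ε := 0) (a := s) (b := t) hf.continuousOn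
      (fun x _ r hr => by
        refine Eventually.frequently ?_
        have h1 := (h x r hr).filter_mono (nhdsWithin_mono x (s := Ioi x) fun z hz => ne_of_gt hz)
        filter_upwards [h1, self_mem_nhdsWithin] with z hz hz'
        rwa [abs_of_pos (sub_pos.2 hz')] at hz)
      le_rfl (fun x _ => by simp) t ⟨hst, le_rfl⟩
    rwa [gronwallBound_ε0, mul_comm, ← abs_of_nonneg (sub_nonneg.2 hst)] at this
  rcases le_total s t with hst | hst
  · exact key f hf h t s hst
  · have := key (fun t => f (-t)) (by fun_prop) (fun t r hr => by
      have h1 := h (-t) r hr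
      have h2 : Tendsto (fun z : ℝ => -z) (𝓝[≠] t) (𝓝[≠] (-t)) := by
        refine tendsto_nhdsWithin_of_tendsto_nhds_of_eventually_within _
          (continuous_neg.continuousAt.mono_left nhdsWithin_le_nhds) ?_
        filter_upwards [self_mem_nhdsWithin] with z hz
        simpa using hz
      filter_upwards [h2.eventually h1] with z hz
      rwa [show -z - -t = -(z - t) by ring, abs_neg] at hz) (-t) (-s) (by linarith)
    simpa [show -t + s = -(t - s) by ring, abs_sub_comm] using this

section FormEvolution

open scoped InnerProductSpace

variable {V : Type*} [NormedAddCommGroup V] [InnerProductSpace ℂ V]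

/-- A family of bounded symmetric operators on `V`, uniformly bounded, uniformly coercive and
Lipschitz continuous in time, all with the same constant `c`. -/
structure CoerciveLipschitzFamily (B : ℝ → V →L[ℂ] V) (c : ℝ) : Prop where
  pos : 0 < c
  symm : ∀ t x y, ⟪B t x, y⟫_ℂ = ⟪x, B t y⟫_ℂ
  coercive : ∀ t x, ‖x‖ ^ 2 ≤ c * (⟪x, B t x⟫_ℂ).re
  bound : ∀ t x, ‖B t x‖ ≤ c * ‖x‖
  lipschitz : ∀ t s x, ‖B t x - B s x‖ ≤ c * |t - s| * ‖x‖

variable {B : ℝ → V →L[ℂ] V} {c : ℝ}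

theorem re_inner_le_norm_mul (x y : V) : |(⟪x, y⟫_ℂ).re| ≤ ‖x‖ * ‖y‖ :=
  (Complex.abs_re_le_norm _).trans (norm_inner_le_norm x y)

theorem hasDerivAt_sq_norm {E : Type*} [NormedAddCommGroup E] [InnerProductSpace ℂ E]
    {u : ℝ → E} {u' : E} {t : ℝ} (hu : HasDerivAt u u' t) :
    HasDerivAt (fun t => ‖u t‖ ^ 2) (2 * (⟪u t, u'⟫_ℂ).re) t := by
  have h := (Complex.reCLM.hasFDerivAt.comp_hasDerivAt t (hu.inner ℂ hu))
  refine (h.congr_deriv ?_).congr_of_eventuallyEq (Eventually.of_forall fun r => ?_)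
  · rw [Complex.reCLM_apply, Complex.add_re, ← inner_conj_symm u', Complex.conj_re]
    ring
  · exact norm_sq_eq_re_inner (𝕜 := ℂ) _

theorem HasDerivAt.continuousLinearMap_complex {E F : Type*} [NormedAddCommGroup E]
    [NormedSpace ℂ E] [NormedAddCommGroup F] [NormedSpace ℂ F] (A : E →L[ℂ] F)
    {u : ℝ → E} {u' : E} {t : ℝ} (hu : HasDerivAt u u' t) :
    HasDerivAt (fun t => A (u t)) (A u') t :=
  (A.restrictScalars ℝ).hasFDerivAt.comp_hasDerivAt t hu

theorem CoerciveLipschitzFamily.continuous (hB : CoerciveLipschitzFamily B c) : Continuous B := by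
  refine (LipschitzWith.of_dist_le_mul (K := ⟨c, hB.pos.le⟩) fun t s => ?_).continuous
  rw [dist_eq_norm, Real.dist_eq]
  refine ContinuousLinearMap.opNorm_le_bound _ (mul_nonneg hB.pos.le (abs_nonneg _)) fun x => ?_
  exact hB.lipschitz t s x

theorem CoerciveLipschitzFamily.re_inner_nonneg (hB : CoerciveLipschitzFamily B c) (t : ℝ)
    (x : V) : 0 ≤ (⟪x, B t x⟫_ℂ).re := by
  have h := (sq_nonneg ‖x‖).trans (hB.coercive t x)
  exact nonneg_of_mul_nonneg_right h hB.pos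

theorem CoerciveLipschitzFamily.re_inner_le (hB : CoerciveLipschitzFamily B c) (t : ℝ)
    (x : V) : (⟪x, B t x⟫_ℂ).re ≤ c * ‖x‖ ^ 2 := by
  have h := (le_abs_self _).trans (re_inner_le_norm_mul x (B t x))
  nlinarith [mul_le_mul_of_nonneg_left (hB.bound t x) (norm_nonneg x)]

theorem CoerciveLipschitzFamily.norm_le_of_energy_le (hB : CoerciveLipschitzFamily B c)
    {t s k : ℝ} {x y : V} (hk : 0 ≤ k)
    (h : (⟪y, B t y⟫_ℂ).re ≤ exp k * (⟪x, B s x⟫_ℂ).re) : ‖y‖ ≤ c * exp k * ‖x‖ := by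
  have hc := hB.pos
  refine le_of_sq_le_sq ?_ (by positivity)
  have h1 : 1 ≤ exp k := one_le_exp hk
  calc ‖y‖ ^ 2 ≤ c * (⟪y, B t y⟫_ℂ).re := hB.coercive t _
    _ ≤ c * (exp k * (c * ‖x‖ ^ 2)) := by
        gcongr
        refine h.trans ?_
        gcongr
        exact hB.re_inner_le s _
    _ = (c ^ 2 * ‖x‖ ^ 2) * exp k := by ring
    _ ≤ (c ^ 2 * ‖x‖ ^ 2) * exp k ^ 2 := by
        gcongr
        nlinarith
    _ = (c * exp k * ‖x‖) ^ 2 := by ring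

theorem CoerciveLipschitzFamily.inner_self_im (hB : CoerciveLipschitzFamily B c) (t : ℝ)
    (x : V) : (⟪x, B t x⟫_ℂ).im = 0 := by
  have h := congrArg Complex.im (inner_conj_symm (𝕜 := ℂ) x (B t x))
  rw [hB.symm, Complex.conj_im] at h
  linarith

theorem CoerciveLipschitzFamily.re_inner_sub (hB : CoerciveLipschitzFamily B c) (t : ℝ) (x y : V) :
    (⟪x - y, B t (x - y)⟫_ℂ).re =
      (⟪x, B t x⟫_ℂ).re - 2 * (⟪x, B t y⟫_ℂ).re + (⟪y, B t y⟫_ℂ).re := by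
  have h1 : (⟪y, B t x⟫_ℂ).re = (⟪x, B t y⟫_ℂ).re := by
    rw [← hB.symm, ← inner_conj_symm, Complex.conj_re]
  simp only [ContinuousLinearMap.map_sub, inner_sub_left, inner_sub_right, Complex.sub_re, h1]
  ring

/-- Hermitian sesquilinear forms, antilinear in the first variable. -/
structure IsHermitianForm (q : V → V → ℂ) : Prop where
  add_left : ∀ x x' y, q (x + x') y = q x y + q x' y
  smul_left : ∀ (r : ℂ) x y, q (r • x) y = conj r * q x y
  herm : ∀ x y, q y x = conj (q x y)

namespace IsHermitianForm

variable {q q' : V → V → ℂ}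

theorem add_right (hq : IsHermitianForm q) (x y y' : V) : q x (y + y') = q x y + q x y' := by
  rw [hq.herm (y + y') x, hq.add_left, map_add, ← hq.herm, ← hq.herm]

theorem smul_right (hq : IsHermitianForm q) (r : ℂ) (x y : V) : q x (r • y) = r * q x y := by
  rw [hq.herm (r • y) x, hq.smul_left, map_mul, Complex.conj_conj, ← hq.herm]

theorem zero_left (hq : IsHermitianForm q) (y : V) : q 0 y = 0 := by
  simpa using hq.smul_left 0 0 y

theorem zero_right (hq : IsHermitianForm q) (x : V) : q x 0 = 0 := by
  simpa using hq.smul_right 0 x 0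

theorem add (hq : IsHermitianForm q) (hq' : IsHermitianForm q') :
    IsHermitianForm fun x y => q x y + q' x y where
  add_left x x' y := by rw [hq.add_left, hq'.add_left]; ring
  smul_left r x y := by rw [hq.smul_left, hq'.smul_left]; ring
  herm x y := by rw [hq.herm, hq'.herm, map_add]

theorem sub (hq : IsHermitianForm q) (hq' : IsHermitianForm q') :
    IsHermitianForm fun x y => q x y - q' x y where
  add_left x x' y := by rw [hq.add_left, hq'.add_left]; ring
  smul_left r x y := by rw [hq.smul_left, hq'.smul_left]; ring
  herm x y := by rw [hq.herm, hq'.herm, map_sub]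

theorem re_le_of_abs_re_le (hq : IsHermitianForm q) {C : ℝ}
    (h : ∀ x, |(q x x).re| ≤ C * ‖x‖ ^ 2) (x y : V) :
    2 * (q x y).re ≤ C * (‖x‖ ^ 2 + ‖y‖ ^ 2) := by
  have h1 := (abs_le.1 (h (x + y))).2
  have h2 := (abs_le.1 (h (x + (-1 : ℂ) • y))).1
  have h3 : (q y x).re = (q x y).re := by rw [hq.herm, Complex.conj_re]
  have h4 := parallelogram_law_with_norm ℂ x y
  rw [sub_eq_add_neg] at h4
  simp only [hq.add_left, hq.add_right, hq.smul_left, hq.smul_right, map_neg, map_one, neg_one_mul,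
    neg_neg, Complex.add_re, Complex.neg_re, h3] at h1 h2
  rw [neg_smul, one_smul] at h2
  have h5 : C * ‖x + y‖ ^ 2 + C * ‖x + -y‖ ^ 2 = 2 * (C * (‖x‖ ^ 2 + ‖y‖ ^ 2)) := by
    linear_combination C * h4
  linarith

/-- A hermitian form is bounded as soon as its quadratic form is, with the same constant. -/
theorem norm_le_of_abs_re_le (hq : IsHermitianForm q) {C : ℝ}
    (h : ∀ x, |(q x x).re| ≤ C * ‖x‖ ^ 2) (x y : V) : ‖q x y‖ ≤ C * ‖x‖ * ‖y‖ := by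
  rcases eq_or_ne x 0 with rfl | hx
  · simp [hq.zero_left]
  rcases eq_or_ne y 0 with rfl | hy
  · simp [hq.zero_right]
  have hx' := norm_pos_iff.2 hx
  have hy' := norm_pos_iff.2 hy
  set N := ‖q x y‖ with hN
  have h1 := hq.re_le_of_abs_re_le h (((N * ‖y‖ : ℝ) : ℂ) • x)
    (((‖x‖ : ℝ) : ℂ) • (conj (q x y) • y))
  rw [hq.smul_left, hq.smul_right, hq.smul_right, Complex.conj_ofReal, mul_comm (conj (q x y)),
    Complex.mul_conj, Complex.normSq_eq_norm_sq, ← hN, ← Complex.ofReal_mul, ← Complex.ofReal_mul,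
    Complex.ofReal_re, norm_smul, norm_smul, norm_smul, RCLike.norm_conj, ← hN, Complex.norm_real,
    Complex.norm_real, Real.norm_of_nonneg (by positivity), Real.norm_of_nonneg (by positivity)]
    at h1
  rcases (norm_nonneg (q x y)).eq_or_lt with h0 | h0
  · have h2 := (abs_nonneg _).trans (h x)
    have h3 : 0 ≤ C := by
      by_contra hC
      have : C * ‖x‖ ^ 2 < 0 := mul_neg_of_neg_of_pos (not_le.1 hC) (by positivity)
      linarith
    rw [hN, ← h0]
    positivity
  · have h2 : 2 * N ^ 2 * ‖x‖ * ‖y‖ * N ≤ 2 * N ^ 2 * ‖x‖ * ‖y‖ * (C * ‖x‖ * ‖y‖) := by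
      linarith
    exact le_of_mul_le_mul_left h2 (by positivity)

end IsHermitianForm

theorem norm_le_of_norm_inner_le {K : ℝ} (hK : 0 ≤ K) {z : V} (h : ∀ y, ‖⟪y, z⟫_ℂ‖ ≤ K * ‖y‖) :
    ‖z‖ ≤ K := by
  have h1 := h z
  rw [← inner_conj_symm, RCLike.norm_conj, ← inner_self_re_eq_norm, inner_self_eq_norm_sq] at h1
  rcases (norm_nonneg z).eq_or_lt with h0 | h0
  · rwa [← h0]
  · rw [pow_two] at h1
    exact le_of_mul_le_mul_right h1 h0

theorem abs_re_sub_le_of_hasDerivWithin {T : ℝ} {a a' : ℝ → V → V → ℂ}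
    (ha : ∀ t ∈ Icc (0 : ℝ) T, IsHermitianForm (a t))
    (ha_deriv : ∀ t ∈ Icc (0 : ℝ) T, ∀ ε : ℝ, 0 < ε → ∃ δ : ℝ, 0 < δ ∧
      ∀ s ∈ Icc (0 : ℝ) T, |s - t| < δ → ∀ x y : V, ‖x‖ ≤ 1 → ‖y‖ ≤ 1 →
        ‖a s x y - a t x y - ((s - t) : ℂ) * a' t x y‖ ≤ ε * |s - t|)
    (ha'_bound : ∀ t ∈ Icc (0 : ℝ) T, ∀ x : V, |(a' t x x).re| ≤ c * ‖x‖ ^ 2)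
    {t s : ℝ} (ht : t ∈ Icc (0 : ℝ) T) (hs : s ∈ Icc (0 : ℝ) T) (x : V) :
    |(a t x x - a s x x).re| ≤ c * |t - s| * ‖x‖ ^ 2 := by
  have hunit : ∀ u : V, ‖u‖ = 1 → |(a t u u - a s u u).re| ≤ c * |t - s| := by
    intro u hu
    have hd : ∀ τ ∈ Icc (0 : ℝ) T,
        HasDerivWithinAt (fun r => (a r u u).re) (a' τ u u).re (Icc 0 T) τ := by
      intro τ hτ
      rw [hasDerivWithinAt_iff_isLittleO, Asymptotics.isLittleO_iff]
      intro ε hε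
      obtain ⟨δ, hδ, h⟩ := ha_deriv τ hτ ε hε
      filter_upwards [self_mem_nhdsWithin, mem_nhdsWithin_of_mem_nhds (Metric.ball_mem_nhds τ hδ)]
        with r hr hr'
      have h1 := h r hr (by simpa [Real.dist_eq] using hr') u u hu.le hu.le
      rw [Real.norm_eq_abs, Real.norm_eq_abs]
      refine le_trans ?_ h1
      refine le_of_eq_of_le ?_ (Complex.abs_re_le_norm _)
      rw [← Complex.ofReal_sub, Complex.sub_re, Complex.sub_re, Complex.re_ofReal_mul, smul_eq_mul]
    have h2 := (convex_Icc (0 : ℝ) T).norm_image_sub_le_of_norm_hasDerivWithin_le (C := c) hd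
      (fun τ hτ => by simpa [hu] using ha'_bound τ hτ u) hs ht
    rwa [Real.norm_eq_abs, Real.norm_eq_abs, ← Complex.sub_re] at h2
  rcases eq_or_ne x 0 with rfl | hx
  · simp [(ha t ht).zero_left, (ha s hs).zero_left]
  have hx' := norm_pos_iff.2 hx
  set u : V := ((‖x‖⁻¹ : ℝ) : ℂ) • x with hu
  have hu1 : ‖u‖ = 1 := by
    rw [hu, norm_smul, Complex.norm_real, Real.norm_of_nonneg (by positivity),
      inv_mul_cancel₀ hx'.ne']
  have hxu : x = ((‖x‖ : ℝ) : ℂ) • u := by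
    rw [hu, smul_smul, ← Complex.ofReal_mul, mul_inv_cancel₀ hx'.ne', Complex.ofReal_one, one_smul]
  have h3 : (a t x x - a s x x).re = ‖x‖ ^ 2 * (a t u u - a s u u).re := by
    have h4 : ∀ r ∈ Icc (0 : ℝ) T, a r x x = ((‖x‖ ^ 2 : ℝ) : ℂ) * a r u u := by
      intro r hr
      conv_lhs => rw [hxu]
      rw [(ha r hr).smul_left, (ha r hr).smul_right, Complex.conj_ofReal]
      push_cast
      ring
    rw [h4 t ht, h4 s hs, ← mul_sub, Complex.re_ofReal_mul]
  rw [h3, abs_mul, abs_of_nonneg (by positivity), mul_comm]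
  exact mul_le_mul_of_nonneg_right (hunit u hu1) (by positivity)

theorem isHermitianForm_inner_apply {E : Type*} [NormedAddCommGroup E]
    [InnerProductSpace ℂ E] (J : V →L[ℂ] E) :
    IsHermitianForm fun x y => ⟪J x, J y⟫_ℂ where
  add_left x x' y := by rw [map_add, inner_add_left]
  smul_left r x y := by rw [map_smul, inner_smul_left]
  herm x y := (inner_conj_symm _ _).symm

variable {ℋ : Type*} [NormedAddCommGroup ℋ] [InnerProductSpace ℂ ℋ] [CompleteSpace ℋ]
  {J : V →L[ℂ] ℋ}

theorem LinearMap.exists_isometric_extension (hJd : DenseRange J) (f : V →ₗ[ℂ] ℋ)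
    (hf : ∀ x, ‖f x‖ = ‖J x‖) :
    ∃ W : ℋ →L[ℂ] ℋ, (∀ x, W (J x) = f x) ∧ ∀ h, ‖W h‖ = ‖h‖ := by
  have h1 : ∀ x, f.extendOfNorm J.toLinearMap (J x) = f x := fun x =>
    LinearMap.extendOfNorm_eq (e := J.toLinearMap) hJd ⟨1, fun x => by simp [hf]⟩ x
  refine ⟨f.extendOfNorm J.toLinearMap, h1, fun h => ?_⟩
  refine hJd.induction_on (p := fun h => ‖f.extendOfNorm J.toLinearMap h‖ = ‖h‖) h
    (isClosed_eq (by fun_prop) (by fun_prop)) fun x => ?_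
  rw [h1, hf]

variable [CompleteSpace V]

/-- `v` is a solution of `(J† J + ε) v' = -i B(t) v`. -/
structure IsRegularizedSolution (J : V →L[ℂ] ℋ) (B : ℝ → V →L[ℂ] V) (ε : ℝ) (v : ℝ → V) :
    Prop where
  differentiable : Differentiable ℝ v
  eq : ∀ t, J.adjoint (J (deriv v t)) + (ε : ℂ) • deriv v t = -Complex.I • B t (v t)

variable {ε δ : ℝ} {v w : ℝ → V}

theorem continuous_regularized_inverse (hε : 0 < ε) :
    ∃ R : V →L[ℂ] V, ∀ x, J.adjoint (J (R x)) + (ε : ℂ) • R x = x := by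
  have hu : IsUnit ((J.adjoint).comp J + (ε : ℂ) • (1 : V →L[ℂ] V)) := by
    refine ContinuousLinearMap.isUnit_of_forall_le_norm_inner_map _ (c := ⟨ε, hε.le⟩) hε ?_
    intro x
    have h1 : ⟪((J.adjoint).comp J + (ε : ℂ) • (1 : V →L[ℂ] V)) x, x⟫_ℂ
        = ((‖J x‖ ^ 2 + ε * ‖x‖ ^ 2 : ℝ) : ℂ) := by
      simp [ContinuousLinearMap.adjoint_inner_left,
        inner_self_eq_norm_sq_to_K]
    rw [h1, Complex.norm_real, norm_of_nonneg (by positivity)]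
    change ‖x‖ ^ 2 * ε ≤ _
    nlinarith [sq_nonneg ‖J x‖]
  obtain ⟨R, hR⟩ := hu.exists_right_inv
  refine ⟨R, fun x => ?_⟩
  simpa using congrArg (fun A : V →L[ℂ] V => A x) hR

theorem exists_isRegularizedSolution (hB : CoerciveLipschitzFamily B c) (hε : 0 < ε) (s : ℝ)
    (x : V) : ∃ v, IsRegularizedSolution J B ε v ∧ v s = x := by
  obtain ⟨R, hR⟩ := continuous_regularized_inverse (J := J) hε
  let A : V →L[ℂ] V := -Complex.I • R
  let M : ℝ → V →L[ℝ] V := fun t => (A.comp (B t)).restrictScalars ℝ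
  have hM : Continuous M :=
    (ContinuousLinearMap.restrictScalarsL ℂ V V ℝ ℝ).continuous.comp
      (continuous_const.clm_comp hB.continuous)
  have hL : ∀ t, ‖M t‖ ≤ ‖A‖ * c := by
    intro t
    have h0 := hB.pos.le
    refine ContinuousLinearMap.opNorm_le_bound _ (by positivity) fun x => ?_
    calc ‖A (B t x)‖ ≤ ‖A‖ * ‖B t x‖ := A.le_opNorm _
      _ ≤ ‖A‖ * (c * ‖x‖) := by gcongr; exact hB.bound t x
      _ = ‖A‖ * c * ‖x‖ := by ring
  obtain ⟨v, hvs, hv⟩ := exists_hasDerivAt_linear_ode hM hL s x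
  refine ⟨v, ⟨fun t => (hv t).differentiableAt, fun t => ?_⟩, hvs⟩
  rw [(hv t).deriv]
  change J.adjoint (J (-Complex.I • R (B t (v t)))) + (ε : ℂ) • (-Complex.I • R (B t (v t))) = _
  rw [map_smul, map_smul, smul_comm (ε : ℂ), ← smul_add, hR]

namespace IsRegularizedSolution

theorem hasDerivAt (hv : IsRegularizedSolution J B ε v) (t : ℝ) :
    HasDerivAt v (deriv v t) t := (hv.differentiable t).hasDerivAt

theorem add (hv : IsRegularizedSolution J B ε v) (hw : IsRegularizedSolution J B ε w) :
    IsRegularizedSolution J B ε (v + w) := by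
  refine ⟨hv.differentiable.add hw.differentiable, fun t => ?_⟩
  rw [((hv.hasDerivAt t).add (hw.hasDerivAt t)).deriv]
  simp only [map_add, smul_add, Pi.add_apply, ← hv.eq, ← hw.eq]
  abel

theorem const_smul (hv : IsRegularizedSolution J B ε v) (a : ℂ) :
    IsRegularizedSolution J B ε (a • v) := by
  refine ⟨hv.differentiable.const_smul a, fun t => ?_⟩
  rw [((hv.hasDerivAt t).const_smul a).deriv]
  simp only [map_smul, Pi.smul_apply]
  rw [smul_comm _ a, smul_comm _ a, ← smul_add, hv.eq]

/-- The regularized `ℋ`-norm is conserved. -/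
theorem conserved (hB : CoerciveLipschitzFamily B c) (hv : IsRegularizedSolution J B ε v)
    (t s : ℝ) : ‖J (v t)‖ ^ 2 + ε * ‖v t‖ ^ 2 = ‖J (v s)‖ ^ 2 + ε * ‖v s‖ ^ 2 := by
  have hd : ∀ t, HasDerivAt (fun t => ‖J (v t)‖ ^ 2 + ε * ‖v t‖ ^ 2) 0 t := by
    intro t
    have h1 := hasDerivAt_sq_norm ((hv.hasDerivAt t).continuousLinearMap_complex J)
    have h2 := (hasDerivAt_sq_norm (hv.hasDerivAt t)).const_mul ε
    refine (h1.add h2).congr_deriv ?_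
    have h3 := congrArg (fun z => (⟪v t, z⟫_ℂ).re) (hv.eq t)
    simp only [inner_add_right, inner_smul_right, ContinuousLinearMap.adjoint_inner_right,
      Complex.add_re, Complex.re_ofReal_mul] at h3
    have h4 : (-Complex.I * ⟪v t, B t (v t)⟫_ℂ).re = 0 := by
      simp [hB.inner_self_im]
    linarith
  exact is_const_of_deriv_eq_zero (fun t => (hd t).differentiableAt) (fun t => (hd t).deriv) t s

theorem unique (hB : CoerciveLipschitzFamily B c) (hε : 0 < ε)
    (hv : IsRegularizedSolution J B ε v) (hw : IsRegularizedSolution J B ε w) {s : ℝ}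
    (h : v s = w s) : v = w := by
  funext t
  have h1 := conserved hB (hv.add (hw.const_smul (-1))) t s
  simp only [Pi.add_apply, h, neg_smul, one_smul, Pi.neg_apply,
    add_neg_cancel, map_zero,
    norm_zero] at h1
  have h2 : ‖v t + -w t‖ ^ 2 = 0 := by
    have := sq_nonneg ‖J (v t + -w t)‖
    have := sq_nonneg ‖v t + -w t‖
    nlinarith
  rwa [sq_eq_zero_iff, norm_eq_zero, ← sub_eq_add_neg, sub_eq_zero] at h2

/-- Growth bound for the energy. -/
theorem energy_le (hB : CoerciveLipschitzFamily B c) (hv : IsRegularizedSolution J B ε v)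
    (t s : ℝ) :
    (⟪v t, B t (v t)⟫_ℂ).re ≤ exp (c ^ 2 * |t - s|) * (⟪v s, B s (v s)⟫_ℂ).re := by
  have hvc : Continuous v := hv.differentiable.continuous
  have hc := hB.pos
  refine le_exp_mul_of_eventually_slope_lt (f := fun t => (⟪v t, B t (v t)⟫_ℂ).re) ?_ ?_ t s
  · exact Complex.continuous_re.comp (hvc.inner (hB.continuous.clm_apply hvc))
  intro t r hr
  have hd : HasDerivAt (fun z => (⟪v z, B t (v z)⟫_ℂ).re) 0 t := by
    have h1 := (Complex.reCLM.hasFDerivAt.comp_hasDerivAt t ((hv.hasDerivAt t).inner ℂ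
      ((hv.hasDerivAt t).continuousLinearMap_complex (B t))))
    refine h1.congr_deriv ?_
    rw [Complex.reCLM_apply, ← hB.symm, Complex.add_re, ← inner_conj_symm (B t (v t)),
      Complex.conj_re]
    have h2 := congrArg (fun z => (⟪deriv v t, Complex.I • z⟫_ℂ).re) (hv.eq t)
    simp only [smul_smul, inner_smul_right, inner_add_right,
      ContinuousLinearMap.adjoint_inner_right, inner_self_eq_norm_sq_to_K] at h2
    have h3 : (Complex.I * (((‖J (deriv v t)‖ : ℝ) : ℂ) ^ 2 + ε * ((‖deriv v t‖ : ℝ) : ℂ) ^ 2)).re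
        = 0 := by
      rw [show (((‖J (deriv v t)‖ : ℝ) : ℂ) ^ 2 + ε * ((‖deriv v t‖ : ℝ) : ℂ) ^ 2)
        = ((‖J (deriv v t)‖ ^ 2 + ε * ‖deriv v t‖ ^ 2 : ℝ) : ℂ) by push_cast; ring]
      rw [Complex.I_mul_re, Complex.ofReal_im, neg_zero]
    have h4 : (⟪deriv v t, B t (v t)⟫_ℂ).re = 0 := by
      rw [show Complex.I * -Complex.I = 1 by simp, one_mul] at h2
      exact h2.symm.trans h3
    linarith
  have hslope : Tendsto (fun z => |(z - t)⁻¹ * ((⟪v z, B t (v z)⟫_ℂ).re - (⟪v t, B t (v t)⟫_ℂ).re)|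
      + c * ‖v z‖ ^ 2) (𝓝[≠] t) (𝓝 (|0| + c * ‖v t‖ ^ 2)) := by
    refine Tendsto.add ?_ ?_
    · have := hasDerivAt_iff_tendsto_slope.1 hd
      exact this.abs
    · exact ((continuous_const.mul (hvc.norm.pow 2)).tendsto t).mono_left nhdsWithin_le_nhds
  have hlt : |0| + c * ‖v t‖ ^ 2 < r := by
    refine lt_of_le_of_lt ?_ hr
    rw [abs_zero, zero_add]
    nlinarith [hB.coercive t (v t)]
  filter_upwards [hslope.eventually (gt_mem_nhds hlt), self_mem_nhdsWithin] with z hz hzt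
  refine lt_of_le_of_lt ?_ hz
  have hpos : 0 < |z - t| := abs_pos.2 (sub_ne_zero.2 hzt)
  rw [abs_mul, abs_inv, ← sub_le_iff_le_add', ← mul_sub, inv_mul_le_iff₀ hpos]
  have h5 : (⟪v z, B z (v z)⟫_ℂ).re - (⟪v z, B t (v z)⟫_ℂ).re ≤ |z - t| * (c * ‖v z‖ ^ 2) := by
    rw [← Complex.sub_re, ← inner_sub_right]
    refine (le_abs_self _).trans ((re_inner_le_norm_mul _ _).trans ?_)
    calc ‖v z‖ * ‖B z (v z) - B t (v z)‖ ≤ ‖v z‖ * (c * |z - t| * ‖v z‖) := by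
          gcongr; exact hB.lipschitz z t _
      _ = _ := by ring
  have h6 := le_abs_self ((⟪v z, B t (v z)⟫_ℂ).re - (⟪v t, B t (v t)⟫_ℂ).re)
  linarith

theorem norm_le (hB : CoerciveLipschitzFamily B c) (hv : IsRegularizedSolution J B ε v)
    (t s : ℝ) : ‖v t‖ ≤ c * exp (c ^ 2 * |t - s|) * ‖v s‖ :=
  hB.norm_le_of_energy_le (by positivity) (hv.energy_le hB t s)

end IsRegularizedSolution

theorem norm_sub_le_mul_of_hasDerivAt {E : Type*} [NormedAddCommGroup E] [NormedSpace ℝ E]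
    {f f' : ℝ → E} {C t η : ℝ} (hη : 0 ≤ η) (hf : ∀ r, HasDerivAt f (f' r) r)
    (hC : ∀ r ∈ Icc t (t + η), ‖f' r‖ ≤ C) : ‖f (t + η) - f t‖ ≤ C * η := by
  have := (convex_Icc t (t + η)).norm_image_sub_le_of_norm_hasDerivWithin_le
    (fun x _ => (hf x).hasDerivWithinAt) hC ⟨le_rfl, by linarith⟩ ⟨by linarith, le_rfl⟩
  rwa [add_sub_cancel_left, norm_of_nonneg hη] at this

namespace IsRegularizedSolution

theorem hasDerivAt_regularized (hv : IsRegularizedSolution J B ε v) (t : ℝ) :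
    HasDerivAt (fun r => J.adjoint (J (v r)) + (ε : ℂ) • v r) (-Complex.I • B t (v t)) t := by
  have h1 := ((hv.hasDerivAt t).continuousLinearMap_complex (J.adjoint.comp J)).add
    ((hv.hasDerivAt t).const_smul (ε : ℂ))
  exact h1.congr_deriv (hv.eq t)

/-- Hölder continuity in `ℋ` of solutions that are bounded in `V`. -/
theorem sq_norm_sub_le (hB : CoerciveLipschitzFamily B c) (hε : 0 ≤ ε)
    (hv : IsRegularizedSolution J B ε v) {I : Set ℝ} (hI : Convex ℝ I) {M : ℝ}
    (hM : ∀ t ∈ I, ‖v t‖ ≤ M) {t r : ℝ} (ht : t ∈ I) (hr : r ∈ I) :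
    ‖J (v t - v r)‖ ^ 2 ≤ 2 * c * M ^ 2 * |t - r| := by
  have hc := hB.pos
  have hM0 : 0 ≤ M := (norm_nonneg _).trans (hM t ht)
  have h1 := hI.norm_image_sub_le_of_norm_hasDerivWithin_le (C := c * M)
    (fun x _ => (hv.hasDerivAt_regularized x).hasDerivWithinAt)
    (fun x hx => by
      rw [norm_smul, norm_neg, Complex.norm_I, one_mul]
      refine (hB.bound x _).trans ?_
      gcongr
      exact hM x hx) hr ht
  have h2 : J.adjoint (J (v t)) + (ε : ℂ) • v t - (J.adjoint (J (v r)) + (ε : ℂ) • v r)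
      = J.adjoint (J (v t - v r)) + (ε : ℂ) • (v t - v r) := by
    simp only [map_sub, smul_sub]
    abel
  rw [h2] at h1
  have h3 : (⟪v t - v r, J.adjoint (J (v t - v r)) + (ε : ℂ) • (v t - v r)⟫_ℂ).re
      = ‖J (v t - v r)‖ ^ 2 + ε * ‖v t - v r‖ ^ 2 := by
    rw [inner_add_right, inner_smul_right, ContinuousLinearMap.adjoint_inner_right,
      Complex.add_re, Complex.re_ofReal_mul, norm_sq_eq_re_inner (𝕜 := ℂ) (J (v t - v r)),
      norm_sq_eq_re_inner (𝕜 := ℂ) (v t - v r)]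
    rfl
  have h4 := (le_abs_self _).trans (re_inner_le_norm_mul (v t - v r)
    (J.adjoint (J (v t - v r)) + (ε : ℂ) • (v t - v r)))
  have h5 : ‖v t - v r‖ ≤ 2 * M :=
    (norm_sub_le _ _).trans (by linarith [hM t ht, hM r hr])
  have h6 : 0 ≤ ε * ‖v t - v r‖ ^ 2 := by positivity
  calc ‖J (v t - v r)‖ ^ 2 ≤ ‖v t - v r‖ *
        ‖J.adjoint (J (v t - v r)) + (ε : ℂ) • (v t - v r)‖ := by linarith
    _ ≤ 2 * M * (c * M * ‖t - r‖) := by gcongr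
    _ = 2 * c * M ^ 2 * |t - r| := by rw [Real.norm_eq_abs]; ring

/-- Time averages over intervals of length `η ≥ √ε` approximately solve the equation with
`ε = 0`. -/
theorem exists_average (hB : CoerciveLipschitzFamily B c) (hε : 0 ≤ ε)
    (hv : IsRegularizedSolution J B ε v) {α β M η : ℝ} (hη : 0 < η) (hη1 : η ≤ 1)
    (hεη : ε ≤ η ^ 2) (hM : ∀ t ∈ Icc α (β + 1), ‖v t‖ ≤ M) :
    ∃ z z' : ℝ → V, ∀ t ∈ Icc α β, HasDerivAt z (z' t) t ∧ ‖z t‖ ≤ M ∧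
      ‖J.adjoint (J (z' t)) + Complex.I • B t (z t)‖ ≤ (c + 2) * M * η ∧
      ‖J (z t - v t)‖ ^ 2 ≤ 2 * c * M ^ 2 * η := by
  have hc := hB.pos
  have hvc : Continuous v := hv.differentiable.continuous
  obtain ⟨W, hW⟩ : ∃ W : ℝ → V, ∀ t, HasDerivAt W (v t) t :=
    ⟨fun t => ∫ r in (0:ℝ)..t, v r, fun t =>
      intervalIntegral.integral_hasDerivAt_right (hvc.intervalIntegrable _ _)
        (hvc.stronglyMeasurableAtFilter _ _) hvc.continuousAt⟩
  have hηC : (η : ℂ) ≠ 0 := by exact_mod_cast hη.ne'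
  have hnη : ‖(η : ℂ)⁻¹‖ = η⁻¹ := by rw [norm_inv, Complex.norm_real, norm_of_nonneg hη.le]
  refine ⟨fun t => (η : ℂ)⁻¹ • (W (t + η) - W t), fun t => (η : ℂ)⁻¹ • (v (t + η) - v t),
    fun t ht => ?_⟩
  have hsub : ∀ r ∈ Icc t (t + η), r ∈ Icc α (β + 1) := fun r hr =>
    ⟨ht.1.trans hr.1, hr.2.trans (by linarith [ht.2])⟩
  have htI : t ∈ Icc t (t + η) := ⟨le_rfl, by linarith⟩
  have htηI : t + η ∈ Icc t (t + η) := ⟨by linarith, le_rfl⟩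
  have hM0 : 0 ≤ M := (norm_nonneg _).trans (hM t (hsub t htI))
  have hlen : ∀ r ∈ Icc t (t + η), |r - t| ≤ η := fun r hr => by
    rw [abs_of_nonneg (sub_nonneg.2 hr.1)]; linarith [hr.2]
  have hz : ‖(η : ℂ)⁻¹ • (W (t + η) - W t)‖ ≤ M := by
    rw [norm_smul, hnη, inv_mul_le_iff₀ hη, mul_comm η]
    exact norm_sub_le_mul_of_hasDerivAt hη.le hW fun r hr => hM r (hsub r hr)
  refine ⟨?_, hz, ?_, ?_⟩
  · exact (((hW (t + η)).comp_add_const t η).sub (hW t)).const_smul _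
  · have h1 : ‖(J.adjoint (J (v (t + η))) + (ε : ℂ) • v (t + η) + Complex.I • B t (W (t + η))) -
        (J.adjoint (J (v t)) + (ε : ℂ) • v t + Complex.I • B t (W t))‖ ≤ (c * η * M) * η := by
      refine norm_sub_le_mul_of_hasDerivAt hη.le (f := fun r => J.adjoint (J (v r)) + (ε : ℂ) • v r + Complex.I • B t (W r))
        (fun r => (hv.hasDerivAt_regularized r).add
          (((hW r).continuousLinearMap_complex (B t)).const_smul Complex.I)) ?_
      intro r hr
      rw [neg_smul, neg_add_eq_sub, ← smul_sub, norm_smul, Complex.norm_I, one_mul,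
        norm_sub_rev]
      refine (hB.lipschitz r t _).trans ?_
      have := hlen r hr
      have := hM r (hsub r hr)
      gcongr
    have h2 : J.adjoint (J ((η : ℂ)⁻¹ • (v (t + η) - v t))) +
        Complex.I • B t ((η : ℂ)⁻¹ • (W (t + η) - W t)) =
        (η : ℂ)⁻¹ • (((J.adjoint (J (v (t + η))) + (ε : ℂ) • v (t + η) +
          Complex.I • B t (W (t + η))) -
          (J.adjoint (J (v t)) + (ε : ℂ) • v t + Complex.I • B t (W t))) -
          (ε : ℂ) • (v (t + η) - v t)) := by
      simp only [map_smul, map_sub]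
      module
    rw [h2, norm_smul, hnη, inv_mul_le_iff₀ hη]
    refine (norm_sub_le _ _).trans ((add_le_add_left h1 _).trans ?_)
    rw [norm_smul, Complex.norm_real, norm_of_nonneg hε]
    have h3 : ‖v (t + η) - v t‖ ≤ 2 * M := (norm_sub_le _ _).trans
      (by linarith [hM t (hsub t htI), hM (t + η) (hsub _ htηI)])
    have h4 : ε * ‖v (t + η) - v t‖ ≤ η ^ 2 * (2 * M) := by gcongr
    nlinarith
  · have hq : 0 ≤ 2 * c * M ^ 2 * η := by positivity
    have h1 : ‖(J (W (t + η)) - (t + η) • J (v t)) - (J (W t) - t • J (v t))‖ ≤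
        √(2 * c * M ^ 2 * η) * η := by
      refine norm_sub_le_mul_of_hasDerivAt hη.le (f := fun r => J (W r) - r • J (v t)) (f' := fun r => J (v r) - J (v t))
        (fun r => ?_) ?_
      · have := (hasDerivAt_id r).smul_const (J (v t))
        rw [one_smul] at this
        exact ((hW r).continuousLinearMap_complex J).sub this
      · intro r hr
        rw [← map_sub]
        refine le_sqrt_of_sq_le ?_
        refine (hv.sq_norm_sub_le hB hε (convex_Icc α (β + 1)) hM (hsub r hr)
          (hsub t htI)).trans ?_
        have := hlen r hr
        gcongr
    have h2 : J ((η : ℂ)⁻¹ • (W (t + η) - W t) - v t) =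
        (η : ℂ)⁻¹ • ((J (W (t + η)) - (t + η) • J (v t)) - (J (W t) - t • J (v t))) := by
      have h3 : (J (W (t + η)) - (t + η) • J (v t)) - (J (W t) - t • J (v t)) =
          J (W (t + η)) - J (W t) - (η : ℂ) • J (v t) := by
        rw [add_smul, Complex.coe_smul]
        abel
      rw [h3, smul_sub _ _ (_ • _), smul_smul, inv_mul_cancel₀ hηC, one_smul]
      simp only [map_smul, map_sub]
    have h3 : ‖J ((η : ℂ)⁻¹ • (W (t + η) - W t) - v t)‖ ≤ √(2 * c * M ^ 2 * η) := by
      rw [h2, norm_smul, hnη, inv_mul_le_iff₀ hη, mul_comm η]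
      exact h1
    calc _ ≤ √(2 * c * M ^ 2 * η) ^ 2 := by gcongr
      _ = _ := sq_sqrt hq

end IsRegularizedSolution

theorem sq_norm_add_le {E : Type*} [SeminormedAddCommGroup E] (x y : E) :
    ‖x + y‖ ^ 2 ≤ 2 * ‖x‖ ^ 2 + 2 * ‖y‖ ^ 2 := by
  have h := norm_add_le x y
  have h' : ‖x + y‖ ^ 2 ≤ (‖x‖ + ‖y‖) ^ 2 := by gcongr
  nlinarith [sq_nonneg (‖x‖ - ‖y‖)]

/-- Stability for approximate solutions which are bounded in `V`. -/
theorem abs_sq_norm_sub_le_of_approximate_solutions (hB : CoerciveLipschitzFamily B c)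
    {z z' y y' : ℝ → V} {I : Set ℝ} (hI : Convex ℝ I) {M θ : ℝ}
    (hz : ∀ t ∈ I, HasDerivAt z (z' t) t ∧ ‖z t‖ ≤ M ∧
      ‖J.adjoint (J (z' t)) + Complex.I • B t (z t)‖ ≤ θ)
    (hy : ∀ t ∈ I, HasDerivAt y (y' t) t ∧ ‖y t‖ ≤ M ∧
      ‖J.adjoint (J (y' t)) + Complex.I • B t (y t)‖ ≤ θ) {t s : ℝ} (ht : t ∈ I) (hs : s ∈ I) :
    ‖J (z t - y t)‖ ^ 2 - ‖J (z s - y s)‖ ^ 2 ≤ 8 * M * θ * |t - s| := by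
  have hM0 : 0 ≤ M := (norm_nonneg _).trans (hz t ht).2.1
  refine (le_abs_self _).trans ?_
  refine hI.norm_image_sub_le_of_norm_hasDerivWithin_le (f := fun t => ‖J (z t - y t)‖ ^ 2)
    (fun r hr => (hasDerivAt_sq_norm
      (((hz r hr).1.sub (hy r hr).1).continuousLinearMap_complex J)).hasDerivWithinAt) ?_ hs ht
  intro r hr
  obtain ⟨-, hz1, hz2⟩ := hz r hr
  obtain ⟨-, hy1, hy2⟩ := hy r hr
  have h1 : ⟪J (z r - y r), J (z' r - y' r)⟫_ℂ =
      ⟪z r - y r, (J.adjoint (J (z' r)) + Complex.I • B r (z r)) -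
        (J.adjoint (J (y' r)) + Complex.I • B r (y r))⟫_ℂ
        - Complex.I * ⟪z r - y r, B r (z r - y r)⟫_ℂ := by
    rw [← inner_smul_right, ← inner_sub_right, ← ContinuousLinearMap.adjoint_inner_right]
    congr 1
    simp only [map_sub]
    module
  have h2 : (Complex.I * ⟪z r - y r, B r (z r - y r)⟫_ℂ).re = 0 := by
    rw [Complex.I_mul_re, hB.inner_self_im, neg_zero]
  have h3 : ‖z r - y r‖ ≤ 2 * M := (norm_sub_le _ _).trans (by linarith)
  change |2 * (⟪J (z r - y r), J (z' r - y' r)⟫_ℂ).re| ≤ _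
  rw [h1, Complex.sub_re, h2, sub_zero, abs_mul, abs_two]
  have h4 := re_inner_le_norm_mul (z r - y r) ((J.adjoint (J (z' r)) + Complex.I • B r (z r)) -
        (J.adjoint (J (y' r)) + Complex.I • B r (y r)))
  have h5 := (norm_sub_le (J.adjoint (J (z' r)) + Complex.I • B r (z r))
        (J.adjoint (J (y' r)) + Complex.I • B r (y r))).trans (add_le_add hz2 hy2)
  have h6 := h4.trans (mul_le_mul h3 h5 (norm_nonneg _) (by positivity))
  linarith

/-- Solutions for different regularization parameters are close to each other. -/
theorem IsRegularizedSolution.sq_norm_sub_le_of_eq (hB : CoerciveLipschitzFamily B c)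
    (hε : 0 ≤ ε) (hδ : 0 ≤ δ) (hv : IsRegularizedSolution J B ε v)
    (hw : IsRegularizedSolution J B δ w) {s t S M η : ℝ} (hη : 0 < η) (hη1 : η ≤ 1)
    (hεη : ε ≤ η ^ 2) (hδη : δ ≤ η ^ 2) (hS : |t - s| ≤ S)
    (hvM : ∀ r, |r - s| ≤ S + 1 → ‖v r‖ ≤ M) (hwM : ∀ r, |r - s| ≤ S + 1 → ‖w r‖ ≤ M)
    (h : v s = w s) :
    ‖J (v t - w t)‖ ^ 2 ≤ (48 * c + 16 * (c + 2) * S) * M ^ 2 * η := by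
  have hc := hB.pos
  have hS0 : 0 ≤ S := (abs_nonneg _).trans hS
  have hM0 : 0 ≤ M := (norm_nonneg _).trans (hvM s (by simp; linarith))
  have hI : ∀ r ∈ Icc (s - S) (s + S + 1), |r - s| ≤ S + 1 := fun r hr =>
    abs_le.2 ⟨by linarith [hr.1], by linarith [hr.2]⟩
  obtain ⟨z, z', hz⟩ := hv.exists_average hB hε hη hη1 hεη (α := s - S) (β := s + S) (M := M)
    fun r hr => hvM r (hI r hr)
  obtain ⟨y, y', hy⟩ := hw.exists_average hB hδ hη hη1 hδη (α := s - S) (β := s + S) (M := M)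
    fun r hr => hwM r (hI r hr)
  have ht : t ∈ Icc (s - S) (s + S) := by
    have := abs_le.1 hS
    exact ⟨by linarith, by linarith⟩
  have hs : s ∈ Icc (s - S) (s + S) := ⟨by linarith, by linarith⟩
  have h1 := abs_sq_norm_sub_le_of_approximate_solutions hB (convex_Icc (s - S) (s + S))
    (fun r hr => ⟨(hz r hr).1, (hz r hr).2.1, (hz r hr).2.2.1⟩)
    (fun r hr => ⟨(hy r hr).1, (hy r hr).2.1, (hy r hr).2.2.1⟩) ht hs
  have h2 : ∀ r ∈ Icc (s - S) (s + S),
      ‖J ((z r - y r) - (v r - w r))‖ ^ 2 ≤ 8 * c * M ^ 2 * η := by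
    intro r hr
    have e : J ((z r - y r) - (v r - w r)) = J (z r - v r) + -J (y r - w r) := by
      simp only [map_sub]; abel
    rw [e]
    refine (sq_norm_add_le _ _).trans ?_
    rw [norm_neg]
    linarith [(hz r hr).2.2.2, (hy r hr).2.2.2]
  have h3 := h2 s hs
  rw [h, sub_self, sub_zero] at h3
  have h4 : J (v t - w t) = J (z t - y t) + -J ((z t - y t) - (v t - w t)) := by
    simp only [map_sub]; abel
  have h5 := sq_norm_add_le (J (z t - y t)) (-J ((z t - y t) - (v t - w t)))
  rw [← h4, norm_neg] at h5
  have h6 : 8 * M * ((c + 2) * M * η) * |t - s| ≤ 8 * M * ((c + 2) * M * η) * S := by gcongr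
  nlinarith [h2 t ht]

theorem exists_tendsto_inner_of_norm_le {ι : Type*} (g : Ultrafilter ι) {u : ι → V} {M : ℝ}
    (hu : ∀ᶠ i in (g : Filter ι), ‖u i‖ ≤ M) :
    ∃ x : V, ∀ y, Tendsto (fun i => ⟪u i, y⟫_ℂ) g (𝓝 ⟪x, y⟫_ℂ) := by
  obtain ⟨f, -, hf⟩ := isCompact_iff_ultrafilter_le_nhds.1
    (WeakDual.isCompact_closedBall (𝕜 := ℂ) (E := V) 0 M)
    (g.map fun i => StrongDual.toWeakDual (InnerProductSpace.toDual ℂ V (u i))) (by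
      rw [Ultrafilter.coe_map, le_principal_iff, mem_map]
      filter_upwards [hu] with i hi
      simpa using hi)
  refine ⟨(InnerProductSpace.toDual ℂ V).symm (WeakDual.toStrongDual f), fun y => ?_⟩
  have h1 := ((WeakDual.eval_continuous y).tendsto f).comp
    (show Tendsto (fun i => StrongDual.toWeakDual (InnerProductSpace.toDual ℂ V (u i))) g (𝓝 f)
      from hf)
  rw [InnerProductSpace.toDual_symm_apply]
  exact h1

theorem inner_eq_of_tendsto_apply {ι : Type*} {l : Filter ι} [l.NeBot] {u : ι → V} {x : V} {h : ℋ}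
    (hx : ∀ y, Tendsto (fun i => ⟪u i, y⟫_ℂ) l (𝓝 ⟪x, y⟫_ℂ))
    (hh : Tendsto (fun i => J (u i)) l (𝓝 h)) : J x = h := by
  refine ext_inner_right ℂ fun z => ?_
  have h1 := hx (J.adjoint z)
  simp only [ContinuousLinearMap.adjoint_inner_right] at h1
  exact tendsto_nhds_unique h1 (hh.inner tendsto_const_nhds)

theorem exists_eq_of_tendsto_apply {ι : Type*} {l : Filter ι} [l.NeBot] {u : ι → V} {M : ℝ} {h : ℋ}
    (hu : ∀ᶠ i in l, ‖u i‖ ≤ M) (hh : Tendsto (fun i => J (u i)) l (𝓝 h)) : ∃ x, J x = h := by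
  obtain ⟨x, hx⟩ := exists_tendsto_inner_of_norm_le (Ultrafilter.of l) (Ultrafilter.of_le l hu)
  exact ⟨x, inner_eq_of_tendsto_apply hx (hh.mono_left (Ultrafilter.of_le l))⟩

/-- A bounded family whose image under an injective operator converges is weakly convergent. -/
theorem tendsto_inner_of_tendsto_apply {ι : Type*} {l : Filter ι} (hJ : Function.Injective J)
    {u : ι → V} {M : ℝ} {x : V} (hu : ∀ᶠ i in l, ‖u i‖ ≤ M)
    (hh : Tendsto (fun i => J (u i)) l (𝓝 (J x))) (y : V) :
    Tendsto (fun i => ⟪u i, y⟫_ℂ) l (𝓝 ⟪x, y⟫_ℂ) := by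
  rw [tendsto_iff_ultrafilter]
  intro g hg
  obtain ⟨x', hx'⟩ := exists_tendsto_inner_of_norm_le g (hg hu)
  have := hJ (inner_eq_of_tendsto_apply hx' (hh.mono_left hg))
  exact this ▸ hx' y

/-- `Q t s` is the limit of the propagators of regularized equations with parameters `e n → 0`. -/
structure IsLimitPropagator (J : V →L[ℂ] ℋ) (B : ℝ → V →L[ℂ] V) (P : ℕ → ℝ → ℝ → V → V)
    (e : ℕ → ℝ) (Q : ℝ → ℝ → V → V) : Prop where
  pos : ∀ n, 0 < e n
  tendsto_zero : Tendsto e atTop (𝓝 0)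
  sol : ∀ n s x, IsRegularizedSolution J B (e n) fun t => P n t s x
  init : ∀ n s x, P n s s x = x
  lim : ∀ t s x, Tendsto (fun n => J (P n t s x)) atTop (𝓝 (J (Q t s x)))

theorem exists_isLimitPropagator (hB : CoerciveLipschitzFamily B c) :
    ∃ P e Q, IsLimitPropagator J B P e Q := by
  let η : ℕ → ℝ := fun n => 1 / ((n : ℝ) + 1)
  have hη : ∀ n, 0 < η n := fun n => Nat.one_div_pos_of_nat
  have hηlim : Tendsto η atTop (𝓝 0) := tendsto_one_div_add_atTop_nhds_zero_nat
  have hηanti : ∀ {m n}, m ≤ n → η n ≤ η m := fun h => Nat.one_div_le_one_div h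
  have hη1 : ∀ n, η n ≤ 1 := fun n => by simpa [η] using hηanti (Nat.zero_le n)
  have hex : ∀ n s x, ∃ v, IsRegularizedSolution J B (η n ^ 2) v ∧ v s = x := fun n s x =>
    exists_isRegularizedSolution hB (pow_pos (hη n) 2) s x
  choose p hp using hex
  have hc := hB.pos
  have hbound : ∀ n t s x, ‖p n s x t‖ ≤ c * exp (c ^ 2 * |t - s|) * ‖x‖ := fun n t s x => by
    simpa [(hp n s x).2] using (hp n s x).1.norm_le hB t s
  have hlim : ∀ t s x, ∃ z, Tendsto (fun n => J (p n s x t)) atTop (𝓝 (J z)) := by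
    intro t s x
    set S := |t - s| with hS
    set M := c * exp (c ^ 2 * (S + 1)) * ‖x‖ with hM
    set K := (48 * c + 16 * (c + 2) * S) * M ^ 2 with hK
    have hMb : ∀ n r, |r - s| ≤ S + 1 → ‖p n s x r‖ ≤ M := fun n r hr =>
      (hbound n r s x).trans (by rw [hM]; gcongr)
    have hcau : CauchySeq fun n => J (p n s x t) := by
      refine cauchySeq_of_le_tendsto_0 (fun N => √(K * η N)) ?_ ?_
      · intro n m N hn hm
        rw [dist_eq_norm, ← map_sub]
        refine Real.le_sqrt_of_sq_le ?_
        exact (hp n s x).1.sq_norm_sub_le_of_eq hB (by positivity) (by positivity) (hp m s x).1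
          (hη N) (hη1 N) (pow_le_pow_left₀ (hη n).le (hηanti hn) 2)
          (pow_le_pow_left₀ (hη m).le (hηanti hm) 2) le_rfl (hMb n) (hMb m)
          ((hp n s x).2.trans (hp m s x).2.symm)
      · have := (Real.continuous_sqrt.tendsto _).comp (hηlim.const_mul K)
        simpa [Function.comp_def] using this
    obtain ⟨h, hh⟩ := cauchySeq_tendsto_of_complete hcau
    obtain ⟨z, rfl⟩ := exists_eq_of_tendsto_apply
      (Eventually.of_forall fun n => hMb n t (by linarith)) hh
    exact ⟨z, hh⟩
  choose q hq using hlim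
  exact ⟨fun n t s x => p n s x t, fun n => η n ^ 2, q, fun n => pow_pos (hη n) 2,
    by simpa using hηlim.pow 2, fun n s x => (hp n s x).1, fun n s x => (hp n s x).2, hq⟩

namespace IsLimitPropagator

variable {P : ℕ → ℝ → ℝ → V → V} {e : ℕ → ℝ} {Q : ℝ → ℝ → V → V}

theorem norm_approx_le (hB : CoerciveLipschitzFamily B c) (hQ : IsLimitPropagator J B P e Q)
    (n : ℕ) (t s : ℝ) (x : V) : ‖P n t s x‖ ≤ c * exp (c ^ 2 * |t - s|) * ‖x‖ := by
  simpa [hQ.init] using (hQ.sol n s x).norm_le hB t s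

theorem tendsto_mul_sq_norm (hQ : IsLimitPropagator J B P e Q) {u : ℕ → V} {M : ℝ}
    (hu : ∀ n, ‖u n‖ ≤ M) : Tendsto (fun n => e n * ‖u n‖ ^ 2) atTop (𝓝 0) := by
  refine squeeze_zero (fun n => mul_nonneg (hQ.pos n).le (sq_nonneg _)) (fun n =>
    mul_le_mul_of_nonneg_left (pow_le_pow_left₀ (norm_nonneg _) (hu n) 2) (hQ.pos n).le) ?_
  simpa using hQ.tendsto_zero.mul_const (M ^ 2)

theorem norm_apply (hB : CoerciveLipschitzFamily B c) (hQ : IsLimitPropagator J B P e Q)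
    (t s : ℝ) (x : V) : ‖J (Q t s x)‖ = ‖J x‖ := by
  have h1 := ((hQ.lim t s x).norm.pow 2).add
    (hQ.tendsto_mul_sq_norm fun n => hQ.norm_approx_le hB n t s x)
  have h2 := (tendsto_const_nhds (x := ‖J x‖ ^ 2)).add
    (hQ.tendsto_mul_sq_norm fun _ => le_refl ‖x‖)
  have h3 : ∀ n, ‖J (P n t s x)‖ ^ 2 + e n * ‖P n t s x‖ ^ 2 = ‖J x‖ ^ 2 + e n * ‖x‖ ^ 2 :=
    fun n => by simpa [hQ.init] using (hQ.sol n s x).conserved hB t s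
  simp only [h3] at h1
  have h4 := tendsto_nhds_unique h1 h2
  rw [add_zero, add_zero] at h4
  exact (pow_left_inj₀ (norm_nonneg _) (norm_nonneg _) two_ne_zero).1 h4

theorem map_add (hJ : Function.Injective J) (hB : CoerciveLipschitzFamily B c)
    (hQ : IsLimitPropagator J B P e Q) (t s : ℝ) (x y : V) :
    Q t s (x + y) = Q t s x + Q t s y := by
  apply hJ
  have h1 : ∀ n, P n t s (x + y) = P n t s x + P n t s y := fun n =>
    congrFun ((hQ.sol n s (x + y)).unique hB (hQ.pos n) ((hQ.sol n s x).add (hQ.sol n s y))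
      (s := s) (by simp [hQ.init])) t
  have h2 := (hQ.lim t s x).add (hQ.lim t s y)
  simp only [← ContinuousLinearMap.map_add, ← h1] at h2
  exact tendsto_nhds_unique (hQ.lim t s (x + y)) h2

theorem map_smul (hJ : Function.Injective J) (hB : CoerciveLipschitzFamily B c)
    (hQ : IsLimitPropagator J B P e Q) (t s : ℝ) (a : ℂ) (x : V) :
    Q t s (a • x) = a • Q t s x := by
  apply hJ
  have h1 : ∀ n, P n t s (a • x) = a • P n t s x := fun n =>
    congrFun ((hQ.sol n s (a • x)).unique hB (hQ.pos n) ((hQ.sol n s x).const_smul a)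
      (s := s) (by simp [hQ.init])) t
  have h2 := (hQ.lim t s x).const_smul a
  simp only [← ContinuousLinearMap.map_smul, ← h1] at h2
  exact tendsto_nhds_unique (hQ.lim t s (a • x)) h2

theorem self (hJ : Function.Injective J) (hQ : IsLimitPropagator J B P e Q) (s : ℝ) (x : V) :
    Q s s x = x := by
  apply hJ
  have h1 := hQ.lim s s x
  simp only [hQ.init] at h1
  exact tendsto_nhds_unique h1 tendsto_const_nhds

theorem comp (hJ : Function.Injective J) (hB : CoerciveLipschitzFamily B c)
    (hQ : IsLimitPropagator J B P e Q) (t r s : ℝ) (x : V) : Q t r (Q r s x) = Q t s x := by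
  apply hJ
  have h1 : ∀ n, ‖J (P n t s x + (-1 : ℂ) • P n t r (Q r s x))‖ ^ 2 ≤
      ‖J (P n r s x + (-1 : ℂ) • Q r s x)‖ ^ 2 + e n * ‖P n r s x + (-1 : ℂ) • Q r s x‖ ^ 2 := by
    intro n
    have := ((hQ.sol n s x).add ((hQ.sol n r (Q r s x)).const_smul (-1))).conserved hB t r
    simp only [Pi.add_apply, Pi.smul_apply, hQ.init] at this
    have h2 : 0 ≤ e n * ‖P n t s x + (-1 : ℂ) • P n t r (Q r s x)‖ ^ 2 :=
      mul_nonneg (hQ.pos n).le (sq_nonneg _)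
    linarith
  have h2 := hQ.tendsto_mul_sq_norm (u := fun n => P n r s x + (-1 : ℂ) • Q r s x) fun n =>
    (norm_add_le _ _).trans (add_le_add_left (hQ.norm_approx_le hB n r s x) _)
  have h3 := (((hQ.lim r s x).add_const ((-1 : ℂ) • J (Q r s x))).norm.pow 2).add h2
  have h4 := ((hQ.lim t s x).add ((hQ.lim t r (Q r s x)).const_smul (-1 : ℂ))).norm.pow 2
  simp only [ContinuousLinearMap.map_add, ContinuousLinearMap.map_smul] at h1
  have h5 := le_of_tendsto_of_tendsto' h4 (by simpa only [ContinuousLinearMap.map_add,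
    ContinuousLinearMap.map_smul] using h3) h1
  simp only [neg_smul, one_smul, add_neg_cancel, norm_zero] at h5
  have h6 : ‖J (Q t s x) + -J (Q t r (Q r s x))‖ ^ 2 = 0 :=
    le_antisymm (by simpa using h5) (sq_nonneg _)
  rw [sq_eq_zero_iff, norm_eq_zero, ← sub_eq_add_neg, sub_eq_zero] at h6
  exact h6.symm

theorem tendsto_inner (hJ : Function.Injective J) (hB : CoerciveLipschitzFamily B c)
    (hQ : IsLimitPropagator J B P e Q) (t s : ℝ) (x y : V) :
    Tendsto (fun n => ⟪P n t s x, y⟫_ℂ) atTop (𝓝 ⟪Q t s x, y⟫_ℂ) :=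
  tendsto_inner_of_tendsto_apply hJ
    (Eventually.of_forall fun n => hQ.norm_approx_le hB n t s x) (hQ.lim t s x) y

theorem energy_le (hJ : Function.Injective J) (hB : CoerciveLipschitzFamily B c)
    (hQ : IsLimitPropagator J B P e Q) (t s : ℝ) (x : V) :
    (⟪Q t s x, B t (Q t s x)⟫_ℂ).re ≤ exp (c ^ 2 * |t - s|) * (⟪x, B s x⟫_ℂ).re := by
  have h1 := (Complex.continuous_re.tendsto _).comp
    (hQ.tendsto_inner hJ hB t s x (B t (Q t s x)))
  have h2 := le_of_tendsto' ((h1.const_mul 2).sub_const ((⟪Q t s x, B t (Q t s x)⟫_ℂ).re))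
    (b := exp (c ^ 2 * |t - s|) * (⟪x, B s x⟫_ℂ).re) fun n => by
      have h3 := hB.re_inner_nonneg t (P n t s x - Q t s x)
      rw [hB.re_inner_sub] at h3
      have h4 := (hQ.sol n s x).energy_le hB t s
      rw [hQ.init] at h4
      simp only [Function.comp_apply]
      linarith
  linarith

theorem norm_le (hJ : Function.Injective J) (hB : CoerciveLipschitzFamily B c)
    (hQ : IsLimitPropagator J B P e Q) (t s : ℝ) (x : V) :
    ‖Q t s x‖ ≤ c * exp (c ^ 2 * |t - s|) * ‖x‖ :=
  hB.norm_le_of_energy_le (by positivity) (hQ.energy_le hJ hB t s x)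

theorem sq_norm_sub_le (hB : CoerciveLipschitzFamily B c) (hQ : IsLimitPropagator J B P e Q)
    {t r s : ℝ} (x : V) (hr : |r - t| ≤ 1) :
    ‖J (Q t s x) - J (Q r s x)‖ ^ 2 ≤
      2 * c * (c * exp (c ^ 2 * (|t - s| + 1)) * ‖x‖) ^ 2 * |t - r| := by
  have hc := hB.pos
  refine le_of_tendsto' (((hQ.lim t s x).sub (hQ.lim r s x)).norm.pow 2) fun n => ?_
  rw [← ContinuousLinearMap.map_sub]
  refine (hQ.sol n s x).sq_norm_sub_le hB (hQ.pos n).le (convex_Icc (t - 1) (t + 1)) ?_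
    ⟨by linarith, by linarith⟩ ⟨by linarith [abs_le.1 hr], by linarith [abs_le.1 hr]⟩
  intro τ hτ
  refine (hQ.norm_approx_le hB n τ s x).trans ?_
  have : |τ - s| ≤ |t - s| + 1 := by
    have h1 : |τ - t| ≤ 1 := abs_le.2 ⟨by linarith [hτ.1], by linarith [hτ.2]⟩
    linarith [abs_sub_le τ t s]
  gcongr

theorem continuous_apply (hB : CoerciveLipschitzFamily B c) (hQ : IsLimitPropagator J B P e Q)
    (s : ℝ) (x : V) : Continuous fun t => J (Q t s x) := by
  rw [continuous_iff_continuousAt]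
  intro t
  rw [ContinuousAt, tendsto_iff_norm_sub_tendsto_zero]
  set K := 2 * c * (c * exp (c ^ 2 * (|t - s| + 1)) * ‖x‖) ^ 2
  have h1 : Tendsto (fun r => √(K * |t - r|)) (𝓝 t) (𝓝 0) := by
    have : Continuous fun r => √(K * |t - r|) := by fun_prop
    simpa using this.tendsto t
  refine squeeze_zero' (Eventually.of_forall fun _ => norm_nonneg _) ?_ h1
  filter_upwards [Metric.closedBall_mem_nhds t one_pos] with r hr
  rw [norm_sub_rev]
  exact Real.le_sqrt_of_sq_le (hQ.sq_norm_sub_le hB x (by simpa [Real.dist_eq] using hr))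

theorem continuous (hJ : Function.Injective J) (hB : CoerciveLipschitzFamily B c)
    (hQ : IsLimitPropagator J B P e Q) (s : ℝ) (x : V) : Continuous fun t => Q t s x := by
  have hc := hB.pos
  rw [continuous_iff_continuousAt]
  intro t
  rw [ContinuousAt, tendsto_iff_norm_sub_tendsto_zero]
  set z := Q t s x with hz
  set E := (⟪z, B t z⟫_ℂ).re with hE
  set M := c * exp (c ^ 2 * 1) * ‖z‖ with hM
  have hM' : ∀ᶠ r in 𝓝 t, ‖Q r s x‖ ≤ M := by
    filter_upwards [Metric.closedBall_mem_nhds t one_pos] with r hr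
    rw [← hQ.comp hJ hB r t s x, ← hz, hM]
    have : |r - t| ≤ 1 := by simpa [Real.dist_eq] using hr
    refine (hQ.norm_le hJ hB r t z).trans ?_
    gcongr
  have hw := (Complex.continuous_re.tendsto _).comp (tendsto_inner_of_tendsto_apply hJ hM'
    ((hQ.continuous_apply hB s x).tendsto t) (B t z))
  have h1 : Tendsto (fun r => √(c * (exp (c ^ 2 * |r - t|) * E + c * |t - r| * M * M -
      2 * (⟪Q r s x, B t z⟫_ℂ).re + E))) (𝓝 t) (𝓝 0) := by
    have h2 : Continuous fun r : ℝ => exp (c ^ 2 * |r - t|) * E + c * |t - r| * M * M := by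
      fun_prop
    have h3 := (((h2.tendsto t).sub (hw.const_mul 2)).add_const E).const_mul c
    have h4 := (Real.continuous_sqrt.tendsto _).comp h3
    refine h4.trans_eq ?_
    congr 1
    simp only [sub_self, abs_zero, mul_zero, Real.exp_zero, one_mul, zero_mul, add_zero, ← hE,
      ← hz]
    rw [show E - 2 * E + E = 0 by ring, mul_zero, Real.sqrt_zero]
  refine squeeze_zero' (Eventually.of_forall fun _ => norm_nonneg _) ?_ h1
  filter_upwards [hM'] with r hr
  refine Real.le_sqrt_of_sq_le ((hB.coercive t _).trans ?_)
  refine mul_le_mul_of_nonneg_left ?_ hc.le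
  rw [hB.re_inner_sub]
  have h5 := hQ.energy_le hJ hB r t z
  rw [hz, hQ.comp hJ hB r t s x, ← hz] at h5
  have h6 : (⟪Q r s x, B t (Q r s x)⟫_ℂ).re - (⟪Q r s x, B r (Q r s x)⟫_ℂ).re ≤
      c * |t - r| * M * M := by
    rw [← Complex.sub_re, ← inner_sub_right]
    have h7 := hB.lipschitz t r (Q r s x)
    have h8 : c * |t - r| * ‖Q r s x‖ ≤ c * |t - r| * M := by gcongr
    calc _ ≤ ‖Q r s x‖ * ‖B t (Q r s x) - B r (Q r s x)‖ :=
          (le_abs_self _).trans (re_inner_le_norm_mul _ _)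
      _ ≤ M * (c * |t - r| * M) := mul_le_mul hr (h7.trans h8) (norm_nonneg _)
          ((norm_nonneg _).trans hr)
      _ = _ := by ring
  linarith

theorem hasDerivAt_inner (hJ : Function.Injective J) (hB : CoerciveLipschitzFamily B c)
    (hQ : IsLimitPropagator J B P e Q) (s : ℝ) (x y : V) (t : ℝ) :
    HasDerivAt (fun τ => ⟪J y, J (Q τ s x)⟫_ℂ) (-Complex.I * ⟪y, B t (Q t s x)⟫_ℂ) t := by
  have hc := hB.pos
  have hcont : Continuous fun τ => -Complex.I * ⟪y, B τ (Q τ s x)⟫_ℂ :=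
    continuous_const.mul (continuous_const.inner
      (hB.continuous.clm_apply (hQ.continuous hJ hB s x)))
  have hIntegral : ∀ t, ⟪J y, J (Q t s x)⟫_ℂ =
      ⟪J y, J x⟫_ℂ + ∫ τ in s..t, -Complex.I * ⟪y, B τ (Q τ s x)⟫_ℂ := by
    intro t
    have hcn : ∀ n, Continuous fun τ => -Complex.I * ⟪y, B τ (P n τ s x)⟫_ℂ := fun n =>
      continuous_const.mul (continuous_const.inner
        (hB.continuous.clm_apply (hQ.sol n s x).differentiable.continuous))
    have h1 : ∀ n, ∫ τ in s..t, -Complex.I * ⟪y, B τ (P n τ s x)⟫_ℂ =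
        (⟪J y, J (P n t s x)⟫_ℂ + e n * ⟪y, P n t s x⟫_ℂ) -
          (⟪J y, J x⟫_ℂ + e n * ⟪y, x⟫_ℂ) := by
      intro n
      have h2 : ∀ τ, HasDerivAt (fun r => ⟪J y, J (P n r s x)⟫_ℂ + e n * ⟪y, P n r s x⟫_ℂ)
          (-Complex.I * ⟪y, B τ (P n τ s x)⟫_ℂ) τ := by
        intro τ
        have h3 := ((hQ.sol n s x).hasDerivAt_regularized τ).continuousLinearMap_complex
          (innerSL ℂ y)
        simp only [innerSL_apply_apply, inner_add_right, inner_smul_right,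
          ContinuousLinearMap.adjoint_inner_right] at h3
        exact h3
      rw [intervalIntegral.integral_eq_sub_of_hasDerivAt (fun τ _ => h2 τ)
        ((hcn n).intervalIntegrable _ _), hQ.init]
    have he : Tendsto (fun n => (e n : ℂ)) atTop (𝓝 0) := by
      simpa [Function.comp_def] using (Complex.continuous_ofReal.tendsto 0).comp hQ.tendsto_zero
    have hweak : ∀ τ z, Tendsto (fun n => ⟪z, P n τ s x⟫_ℂ) atTop (𝓝 ⟪z, Q τ s x⟫_ℂ) := by
      intro τ z
      have h2 := (Complex.continuous_conj.tendsto _).comp (hQ.tendsto_inner hJ hB τ s x z)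
      simpa [Function.comp_def] using h2
    have h4 : Tendsto (fun n => (⟪J y, J (P n t s x)⟫_ℂ + e n * ⟪y, P n t s x⟫_ℂ) -
          (⟪J y, J x⟫_ℂ + e n * ⟪y, x⟫_ℂ)) atTop (𝓝 (⟪J y, J (Q t s x)⟫_ℂ - ⟪J y, J x⟫_ℂ)) := by
      have h5 := (((tendsto_const_nhds (x := J y)).inner (𝕜 := ℂ) (hQ.lim t s x)).add
        (he.mul (hweak t y))).sub ((he.mul_const ⟪y, x⟫_ℂ).const_add ⟪J y, J x⟫_ℂ)
      simpa using h5
    have h6 : Tendsto (fun n => ∫ τ in s..t, -Complex.I * ⟪y, B τ (P n τ s x)⟫_ℂ) atTop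
        (𝓝 (∫ τ in s..t, -Complex.I * ⟪y, B τ (Q τ s x)⟫_ℂ)) := by
      refine intervalIntegral.tendsto_integral_filter_of_dominated_convergence
        (fun _ => ‖y‖ * (c * (c * exp (c ^ 2 * |t - s|) * ‖x‖)))
        (Eventually.of_forall fun n => (hcn n).aestronglyMeasurable) ?_
        intervalIntegrable_const ?_
      · refine Eventually.of_forall fun n => Eventually.of_forall fun τ hτ => ?_
        have h7 : |τ - s| ≤ |t - s| := by
          have := abs_sub_left_of_mem_uIcc (uIoc_subset_uIcc hτ)
          simpa using this
        rw [norm_mul, norm_neg, Complex.norm_I, one_mul]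
        refine (norm_inner_le_norm _ _).trans ?_
        refine mul_le_mul_of_nonneg_left ((hB.bound τ _).trans ?_) (norm_nonneg _)
        refine mul_le_mul_of_nonneg_left ((hQ.norm_approx_le hB n τ s x).trans ?_) hc.le
        gcongr
      · refine Eventually.of_forall fun τ _ => ?_
        simp only [← hB.symm]
        exact (hweak τ _).const_mul _
    simp only [h1] at h6
    rw [tendsto_nhds_unique h6 h4]
    ring
  have h8 := (hcont.integral_hasStrictDerivAt s t).hasDerivAt.const_add ⟪J y, J x⟫_ℂ
  exact h8.congr_of_eventuallyEq (Eventually.of_forall hIntegral)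

end IsLimitPropagator

theorem IsLimitPropagator.exists_extension {P : ℕ → ℝ → ℝ → V → V} {e : ℕ → ℝ}
    {Q : ℝ → ℝ → V → V} (hJ : Function.Injective J) (hJd : DenseRange J)
    (hB : CoerciveLipschitzFamily B c) (hQ : IsLimitPropagator J B P e Q) :
    ∃ W : ℝ → ℝ → ℋ →L[ℂ] ℋ, (∀ t s x, W t s (J x) = J (Q t s x)) ∧
      (∀ t s h, ‖W t s h‖ = ‖h‖) ∧ (∀ t, W t t = 1) ∧
      (∀ t r s, (W t r).comp (W r s) = W t s) ∧ ∀ h, Continuous fun q : ℝ × ℝ => W q.1 q.2 h := by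
  have hex : ∀ t s, ∃ W : ℋ →L[ℂ] ℋ, (∀ x, W (J x) = J (Q t s x)) ∧ ∀ h, ‖W h‖ = ‖h‖ := by
    intro t s
    exact LinearMap.exists_isometric_extension hJd
      { toFun := fun x => J (Q t s x)
        map_add' := fun x y => by rw [hQ.map_add hJ hB, ContinuousLinearMap.map_add]
        map_smul' := fun a x => by
          rw [hQ.map_smul hJ hB, ContinuousLinearMap.map_smul, RingHom.id_apply] }
      (hQ.norm_apply hB t s)
  choose W hWJ hWn using hex
  have hself : ∀ t, W t t = 1 := fun t => ContinuousLinearMap.ext fun h =>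
    hJd.induction_on (p := fun h => W t t h = h) h (isClosed_eq (by fun_prop) (by fun_prop))
      fun x => by rw [hWJ, hQ.self hJ]
  have hcomp : ∀ t r s h, W t r (W r s h) = W t s h := fun t r s h =>
    hJd.induction_on (p := fun h => W t r (W r s h) = W t s h) h
      (isClosed_eq (by fun_prop) (by fun_prop)) fun x => by
        rw [hWJ, hWJ, hWJ, hQ.comp hJ hB]
  refine ⟨W, hWJ, hWn, hself, fun t r s => ContinuousLinearMap.ext (hcomp t r s), fun h => ?_⟩
  have hcont : ∀ s h, Continuous fun t => W t s h := by
    intro s h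
    refine continuous_of_uniform_approx_of_continuous fun u hu => ?_
    obtain ⟨ρ, hρ, hρu⟩ := Metric.mem_uniformity_dist.1 hu
    obtain ⟨x, hx⟩ := hJd.exists_dist_lt h hρ
    refine ⟨fun t => W t s (J x), ?_, fun t => hρu ?_⟩
    · simp only [hWJ]
      exact hQ.continuous_apply hB s x
    · rwa [dist_eq_norm, ← ContinuousLinearMap.map_sub, hWn, ← dist_eq_norm]
  rw [continuous_iff_continuousAt]
  rintro ⟨t₀, s₀⟩
  rw [ContinuousAt, tendsto_iff_norm_sub_tendsto_zero]
  set g := W 0 s₀ h with hg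
  have hlim : Tendsto (fun q : ℝ × ℝ => ‖W s₀ 0 g - W q.2 0 g‖ + ‖W q.1 0 g - W t₀ 0 g‖)
      (𝓝 (t₀, s₀)) (𝓝 0) := by
    have h0 := hcont 0 g
    have h1 : Continuous
        fun q : ℝ × ℝ => ‖W s₀ 0 g - W q.2 0 g‖ + ‖W q.1 0 g - W t₀ 0 g‖ :=
      (continuous_const.sub (h0.comp continuous_snd)).norm.add
        ((h0.comp continuous_fst).sub continuous_const).norm
    simpa using h1.tendsto (t₀, s₀)
  refine squeeze_zero (fun _ => norm_nonneg _) (fun q => ?_) hlim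
  obtain ⟨t, s⟩ := q
  have h1 : ‖W s₀ 0 g - W s 0 g‖ = ‖W t s h - W t 0 g‖ := by
    rw [← hWn t s (W s₀ 0 g - W s 0 g), ContinuousLinearMap.map_sub, hcomp, hg, hcomp, hself]
    rfl
  have h2 : W t₀ 0 g = W t₀ s₀ h := hcomp t₀ 0 s₀ h
  rw [h1, h2]
  exact norm_sub_le_norm_sub_add_norm_sub _ _ _

theorem IsHermitianForm.exists_operator {q : V → V → ℂ} (hq : IsHermitianForm q) {C : ℝ}
    (h : ∀ x, |(q x x).re| ≤ C * ‖x‖ ^ 2) : ∃ A : V →L[ℂ] V, ∀ x y, ⟪x, A y⟫_ℂ = q x y := by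
  let F : V →L⋆[ℂ] V →L[ℂ] ℂ :=
    LinearMap.mkContinuous₂ (LinearMap.mk₂'ₛₗ (starRingEnd ℂ) (RingHom.id ℂ) q hq.add_left
      hq.smul_left hq.add_right hq.smul_right) C (hq.norm_le_of_abs_re_le h)
  refine ⟨InnerProductSpace.continuousLinearMapOfBilin F, fun x y => ?_⟩
  rw [← inner_conj_symm, InnerProductSpace.continuousLinearMapOfBilin_apply, hq.herm y x]
  rfl

theorem exists_coerciveLipschitzFamily {E : Type*} [NormedAddCommGroup E]
    [InnerProductSpace ℂ E] (J : V →L[ℂ] E) {T : ℝ} (hT : 0 < T)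
    {a a' : ℝ → V → V → ℂ} (ha : ∀ t ∈ Icc (0 : ℝ) T, IsHermitianForm (a t)) (hc : 0 < c)
    (ha_equiv : ∀ t ∈ Icc (0 : ℝ) T, ∀ x : V,
      c⁻¹ * ‖x‖ ^ 2 ≤ (a t x x).re + ‖J x‖ ^ 2 ∧ (a t x x).re + ‖J x‖ ^ 2 ≤ c * ‖x‖ ^ 2)
    (ha_deriv : ∀ t ∈ Icc (0 : ℝ) T, ∀ ε : ℝ, 0 < ε → ∃ δ : ℝ, 0 < δ ∧
      ∀ s ∈ Icc (0 : ℝ) T, |s - t| < δ → ∀ x y : V, ‖x‖ ≤ 1 → ‖y‖ ≤ 1 →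
        ‖a s x y - a t x y - ((s - t) : ℂ) * a' t x y‖ ≤ ε * |s - t|)
    (ha'_bound : ∀ t ∈ Icc (0 : ℝ) T, ∀ x : V, |(a' t x x).re| ≤ c * ‖x‖ ^ 2) :
    ∃ B : ℝ → V →L[ℂ] V, CoerciveLipschitzFamily B c ∧
      ∀ t ∈ Icc (0 : ℝ) T, ∀ x y, ⟪x, B t y⟫_ℂ = a t x y + ⟪J x, J y⟫_ℂ := by
  let b : ℝ → V → V → ℂ := fun t x y => a (projIcc 0 T hT.le t) x y + ⟪J x, J y⟫_ℂ
  have hb : ∀ t, IsHermitianForm (b t) := fun t =>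
    (ha _ (projIcc 0 T hT.le t).2).add (isHermitianForm_inner_apply J)
  have hbre : ∀ t x, (b t x x).re = (a (projIcc 0 T hT.le t) x x).re + ‖J x‖ ^ 2 := by
    intro t x
    rw [Complex.add_re, ← inner_self_eq_norm_sq (𝕜 := ℂ)]
    rfl
  have hbbound : ∀ t x, |(b t x x).re| ≤ c * ‖x‖ ^ 2 := by
    intro t x
    have h1 := ha_equiv _ (projIcc 0 T hT.le t).2 x
    rw [hbre, abs_of_nonneg ((by positivity : 0 ≤ c⁻¹ * ‖x‖ ^ 2).trans h1.1)]
    exact h1.2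
  choose B hBb using fun t => (hb t).exists_operator (hbbound t)
  refine ⟨B, ⟨hc, fun t x y => ?_, fun t x => ?_, fun t x => ?_, fun t s x => ?_⟩,
    fun t ht x y => ?_⟩
  · rw [hBb, ← inner_conj_symm, hBb, ← (hb t).herm]
  · have h1 := (ha_equiv _ (projIcc 0 T hT.le t).2 x).1
    rwa [← hbre, ← hBb, inv_mul_le_iff₀ hc] at h1
  · refine norm_le_of_norm_inner_le (by positivity) fun y => ?_
    rw [hBb, mul_right_comm]
    exact (hb t).norm_le_of_abs_re_le (hbbound t) y x
  · refine norm_le_of_norm_inner_le (by positivity) fun y => ?_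
    rw [inner_sub_right, hBb, hBb, mul_right_comm]
    refine ((hb t).sub (hb s)).norm_le_of_abs_re_le (fun z => ?_) y x
    have h1 := abs_re_sub_le_of_hasDerivWithin ha ha_deriv ha'_bound
      (projIcc 0 T hT.le t).2 (projIcc 0 T hT.le s).2 z
    simp only [b, add_sub_add_right_eq_sub]
    exact h1.trans (mul_le_mul_of_nonneg_right
      (mul_le_mul_of_nonneg_left (abs_projIcc_sub_projIcc hT.le) hc.le) (sq_nonneg _))
  · rw [hBb]
    simp only [b, projIcc_of_mem hT.le ht]

end FormEvolution

/-- **Theorem of Kisyński (Theorem 2.23, simplified version).**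
Let `H ≥ 0` be self-adjoint on a Hilbert space `ℋ` and let
`ℋ₊₁ ⊂ ℋ ⊂ ℋ₋₁` be the associated scale of spaces; abstractly, `ℋ₊₁` is a
Hilbert space `V` densely and contractively embedded in `ℋ` via `J`
(`V = D(H^{1/2})` with `(x,y)₊₁ = (x,(H+1)y)`, so `‖Jx‖ ≤ ‖x‖_V`).
For `t ∈ [0,T]` let `H(t)` be symmetric bilinear forms `a t` on `ℋ₊₁ × ℋ₊₁`
with `c⁻¹(H+1) ≤ H(t)+1 ≤ c(H+1)`, continuously differentiable in the norm of
`B(ℋ₊₁,ℋ₋₁)` with derivative `±Ḣ(t) ≤ c(H+1)`. Then there is a unitary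
propagator `U(t,s)` on `ℋ` such that for `x ∈ ℋ₊₁`, `t ↦ U(t,s)x ∈ ℋ₊₁` is
continuous and `(d/dt) U(t,s)x = −iH(t)U(t,s)x` (as an identity in `ℋ₋₁`,
i.e. tested against arbitrary `y ∈ ℋ₊₁`). -/
theorem kisynski_form_wellposedness
    {ℋ : Type*} [NormedAddCommGroup ℋ] [InnerProductSpace ℂ ℋ] [CompleteSpace ℋ]
    {V : Type*} [NormedAddCommGroup V] [InnerProductSpace ℂ V] [CompleteSpace V]
    -- the embedding `J : ℋ₊₁ = D(H^{1/2}) → ℋ`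
    (J : V →L[ℂ] ℋ) (hJ_inj : Function.Injective J)
    (hJ_dense : DenseRange J) (hJ_contr : ∀ v : V, ‖J v‖ ≤ ‖v‖)
    (T : ℝ) (hT : 0 < T)
    -- the forms `H(t) = a t` and their time derivative `Ḣ(t) = a' t`
    (a a' : ℝ → V → V → ℂ)
    (ha_addl : ∀ t ∈ Icc (0:ℝ) T, ∀ x x' y : V,
      a t (x + x') y = a t x y + a t x' y)
    (ha_smull : ∀ t ∈ Icc (0:ℝ) T, ∀ (c : ℂ) (x y : V),
      a t (c • x) y = conj c * a t x y)
    (ha_herm : ∀ t ∈ Icc (0:ℝ) T, ∀ x y : V, a t y x = conj (a t x y))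
    -- `c⁻¹ (H+1) ≤ H(t) + 1 ≤ c (H+1)`
    (c : ℝ) (hc : 0 < c)
    (ha_equiv : ∀ t ∈ Icc (0:ℝ) T, ∀ x : V,
      c⁻¹ * ‖x‖ ^ 2 ≤ (a t x x).re + ‖J x‖ ^ 2 ∧
      (a t x x).re + ‖J x‖ ^ 2 ≤ c * ‖x‖ ^ 2)
    -- `t ↦ H(t) ∈ B(ℋ₊₁, ℋ₋₁)` is continuously differentiable in norm,
    -- with derivative `a'`
    (ha_deriv : ∀ t ∈ Icc (0:ℝ) T, ∀ ε : ℝ, 0 < ε → ∃ δ : ℝ, 0 < δ ∧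
      ∀ s ∈ Icc (0:ℝ) T, |s - t| < δ → ∀ x y : V, ‖x‖ ≤ 1 → ‖y‖ ≤ 1 →
        ‖a s x y - a t x y - ((s - t) : ℂ) * a' t x y‖ ≤ ε * |s - t|)
    (ha'_cont : ∀ t ∈ Icc (0:ℝ) T, ∀ ε : ℝ, 0 < ε → ∃ δ : ℝ, 0 < δ ∧
      ∀ s ∈ Icc (0:ℝ) T, |s - t| < δ → ∀ x y : V, ‖x‖ ≤ 1 → ‖y‖ ≤ 1 →
        ‖a' s x y - a' t x y‖ ≤ ε)
    -- `±Ḣ(t) ≤ c (H+1)`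
    (ha'_bound : ∀ t ∈ Icc (0:ℝ) T, ∀ x : V, |(a' t x x).re| ≤ c * ‖x‖ ^ 2) :
    ∃ U : ℝ → ℝ → ℋ →L[ℂ] ℋ,
      -- `U` is a unitary propagator on `ℋ`
      (∀ t ∈ Icc (0:ℝ) T, ∀ s ∈ Icc (0:ℝ) T,
        Isometry (U t s) ∧ Function.Surjective (U t s)) ∧
      (∀ t ∈ Icc (0:ℝ) T, U t t = 1) ∧
      (∀ t ∈ Icc (0:ℝ) T, ∀ r ∈ Icc (0:ℝ) T, ∀ s ∈ Icc (0:ℝ) T,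
        (U t r).comp (U r s) = U t s) ∧
      (∀ x : ℋ, ContinuousOn (fun q : ℝ × ℝ => U q.1 q.2 x)
        (Icc (0:ℝ) T ×ˢ Icc (0:ℝ) T)) ∧
      -- invariance of `ℋ₊₁`, continuity in `ℋ₊₁`, and the Schrödinger
      -- equation in `ℋ₋₁`
      (∀ s ∈ Icc (0:ℝ) T, ∀ v : V, ∃ w : ℝ → V,
        (∀ t ∈ Icc (0:ℝ) T, J (w t) = U t s (J v)) ∧
        ContinuousOn w (Icc (0:ℝ) T) ∧
        ∀ y : V, ∀ t ∈ Icc (0:ℝ) T,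
          HasDerivWithinAt
            (fun τ => (inner ℂ (J y) (U τ s (J v)) : ℂ))
            (-Complex.I * a t y (w t)) (Icc (0:ℝ) T) t) := by
  have ha : ∀ t ∈ Icc (0 : ℝ) T, IsHermitianForm (a t) := fun t ht =>
    ⟨ha_addl t ht, ha_smull t ht, ha_herm t ht⟩
  obtain ⟨B, hB, hBa⟩ :=
    exists_coerciveLipschitzFamily J hT ha hc ha_equiv ha_deriv ha'_bound
  obtain ⟨P, e, Q, hQ⟩ := exists_isLimitPropagator (J := J) hB
  obtain ⟨W, hWJ, hWn, hWself, hWcomp, hWc⟩ := hQ.exists_extension hJ_inj hJ_dense hB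
  let φ : ℝ → ℂ := fun r => Complex.exp (Complex.I * r)
  have hφ : ∀ r, HasDerivAt φ (Complex.I * φ r) r := by
    intro r
    have h1 := (((hasDerivAt_id r).ofReal_comp.const_mul Complex.I).cexp)
    simpa [φ, mul_comm] using h1
  have hφc : Continuous φ := continuous_iff_continuousAt.2 fun r => (hφ r).continuousAt
  have hφn : ∀ r, ‖φ r‖ = 1 := fun r => by
    simp only [φ]
    rw [mul_comm, Complex.norm_exp_ofReal_mul_I]
  have hφ0 : φ 0 = 1 := by simp [φ]
  have hφadd : ∀ r r', φ r * φ r' = φ (r + r') := fun r r' => by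
    simp only [φ]
    rw [← Complex.exp_add]
    push_cast
    ring_nf
  let U : ℝ → ℝ → ℋ →L[ℂ] ℋ := fun t s => φ (t - s) • W t s
  have hU : ∀ t s h, U t s h = φ (t - s) • W t s h := fun _ _ _ => rfl
  have hself : ∀ t, U t t = 1 := fun t => by simp [U, hφ0, hWself]
  have hcomp : ∀ t r s, (U t r).comp (U r s) = U t s := by
    intro t r s
    rw [ContinuousLinearMap.smul_comp, ContinuousLinearMap.comp_smul, hWcomp, smul_smul, hφadd,
      sub_add_sub_cancel]
  refine ⟨U, fun t _ s _ => ⟨?_, fun h => ⟨U s t h, ?_⟩⟩, fun t _ => hself t,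
    fun t _ r _ s _ => hcomp t r s, fun h => ?_, fun s hs v => ?_⟩
  · refine AddMonoidHomClass.isometry_of_norm _ fun h => ?_
    rw [hU, norm_smul, hφn, hWn, one_mul]
  · rw [← ContinuousLinearMap.comp_apply, hcomp, hself]
    rfl
  · exact ((hφc.comp (continuous_fst.sub continuous_snd)).smul (hWc h)).continuousOn
  have hφs : ∀ t, HasDerivAt (fun τ => φ (τ - s)) (Complex.I * φ (t - s)) t := fun t =>
    (hφ (t - s)).comp_sub_const t s
  refine ⟨fun t => φ (t - s) • Q t s v, fun t _ => ?_, ?_, fun y t ht => ?_⟩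
  · rw [hU, map_smul, hWJ]
  · exact ((hφc.comp (continuous_id.sub continuous_const)).smul
      (hQ.continuous hJ_inj hB s v)).continuousOn
  · have h1 := (hφs t).mul (hQ.hasDerivAt_inner hJ_inj hB s v y t)
    have h2 : a t y (φ (t - s) • Q t s v) = φ (t - s) * a t y (Q t s v) :=
      (ha t ht).smul_right _ _ _
    refine (h1.congr_deriv ?_).hasDerivWithinAt.congr_of_eventuallyEq
      (Eventually.of_forall fun τ => ?_) ?_
    · rw [hBa t ht, h2]
      ring
    · simp only [Pi.mul_apply, hU, hWJ, inner_smul_right]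
    · simp only [Pi.mul_apply, hU, hWJ, inner_smul_right]
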